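/- There exist absolute constants c > 0 and C > 0 such that the following holds. Let F be a field, let P be a finite set of m points in F^2 and let L be a finite set of n lines in F^2, with m^{7/8} < n < m^{8/7}. If F has positive characteristic p, assume additionally that m^{-2} n^{13} ≤ c · p^{15}. Then I(P,L) ≤ C · m^{11/15} n^{11/15}. -/

import Mathlib

open scoped Classical

/-- A line in `F^2`: the set of points `(x, y)` with `α·x + β·y = γ`, where `(α, β) ≠ (0, 0)`. -/
def IsLine {F : Type*} [Field F] (ℓ : Set (F × F)) : Prop :=
  ∃ α β γ : F, (α, β) ≠ (0, 0) ∧ ℓ = {p : F × F | α * p.1 + β * p.2 = γ}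

/-- The number of incidences between a finite set of points and a finite set of lines. -/
noncomputable def Incidences {F : Type*} [Field F]
    (P : Finset (F × F)) (L : Finset (Set (F × F))) : ℕ :=
  Set.ncard {ql : (F × F) × Set (F × F) | ql.1 ∈ P ∧ ql.2 ∈ L ∧ ql.1 ∈ ql.2}

open Polynomial in
/-- Two polynomials of small degree with vanishing Wronskian are proportional. -/
theorem exists_eq_C_mul_of_derivative_mul_eq {K : Type*} [Field K] {M : ℕ}
    (hM : ∀ j : ℕ, 0 < j → j ≤ M → (j : K) ≠ 0) {f g : K[X]} (hg : g ≠ 0)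
    (hgM : g.natDegree ≤ M) (hfM : f.natDegree ≤ M)
    (h : derivative f * g = f * derivative g) : ∃ r : K, f = C r * g := by
  have key : ∀ f : K[X], f ≠ 0 → f.natDegree ≤ M → derivative f * g = f * derivative g →
      f.natDegree = g.natDegree := by
    intro f hf hfM h
    have hcoef : ∀ q : K[X], (derivative q).coeff (q.natDegree - 1) =
        q.leadingCoeff * q.natDegree := by
      intro q
      rcases Nat.eq_zero_or_pos q.natDegree with h0 | h0
      · rw [Polynomial.eq_C_of_natDegree_eq_zero h0]; simp
      · rw [coeff_derivative, ← Nat.cast_succ, Nat.succ_eq_add_one, Nat.sub_add_cancel h0]; rfl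
    have hXder : ∀ q : K[X], (X * derivative q).coeff q.natDegree =
        q.leadingCoeff * q.natDegree := by
      intro q
      rcases Nat.eq_zero_or_pos q.natDegree with h0 | h0
      · rw [h0]; simp
      · obtain ⟨k, hk⟩ : ∃ k, q.natDegree = k + 1 := ⟨q.natDegree - 1, by omega⟩
        rw [← hcoef, hk, coeff_X_mul]; rfl
    have hdeg : ∀ q : K[X], (X * derivative q).natDegree ≤ q.natDegree := by
      intro q
      rcases Nat.eq_zero_or_pos q.natDegree with h0 | h0
      · rw [Polynomial.eq_C_of_natDegree_eq_zero h0]; simp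
      · refine natDegree_mul_le.trans ?_
        have := natDegree_derivative_le q
        simp only [natDegree_X]; omega
    have h1 : (X * derivative f) * g = f * (X * derivative g) := by linear_combination X * h
    have h2 := congrArg (fun q => q.coeff (f.natDegree + g.natDegree)) h1
    rw [coeff_mul_add_eq_of_natDegree_le (hdeg f) le_rfl, coeff_mul_add_eq_of_natDegree_le le_rfl (hdeg g),
      hXder, hXder] at h2
    have hlf : f.leadingCoeff ≠ 0 := leadingCoeff_ne_zero.2 hf
    have hlg : g.leadingCoeff ≠ 0 := leadingCoeff_ne_zero.2 hg
    have h3 : (f.natDegree : K) = g.natDegree := by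
      have h2' : f.leadingCoeff * f.natDegree * g.leadingCoeff =
        f.leadingCoeff * (g.leadingCoeff * g.natDegree) := h2
      have : f.leadingCoeff * g.leadingCoeff * ((f.natDegree : K) - g.natDegree) = 0 := by
        linear_combination h2'
      rcases mul_eq_zero.1 this with h | h
      · exact absurd h (mul_ne_zero hlf hlg)
      · exact sub_eq_zero.1 h
    rcases lt_trichotomy f.natDegree g.natDegree with hlt | heq | hlt
    · exact absurd (by push_cast [Nat.cast_sub hlt.le]; rw [h3, sub_self])
        (hM (g.natDegree - f.natDegree) (by omega) (by omega))
    · exact heq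
    · exact absurd (by push_cast [Nat.cast_sub hlt.le]; rw [h3, sub_self])
        (hM (f.natDegree - g.natDegree) (by omega) (by omega))
  by_cases hf : f = 0
  · exact ⟨0, by simp [hf]⟩
  have hlg : g.leadingCoeff ≠ 0 := leadingCoeff_ne_zero.2 hg
  have hfg := key f hf hfM h
  refine ⟨f.leadingCoeff / g.leadingCoeff, ?_⟩
  set r := f.leadingCoeff / g.leadingCoeff with hr
  have hr0 : r ≠ 0 := div_ne_zero (leadingCoeff_ne_zero.2 hf) hlg
  by_contra hne
  have hd : f - C r * g ≠ 0 := sub_ne_zero.2 hne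
  have hle : (f - C r * g).natDegree ≤ g.natDegree :=
    (natDegree_sub_le _ _).trans (by rw [natDegree_C_mul hr0, hfg, max_self])
  have h4 := key (f - C r * g) hd (hle.trans hgM) (by
    simp only [derivative_sub, derivative_C_mul]; linear_combination h)
  have h5 : (f - C r * g).coeff g.natDegree = 0 := by
    rw [coeff_sub, coeff_C_mul, ← hfg]
    nth_rewrite 2 [hfg]
    change f.leadingCoeff - r * g.leadingCoeff = 0
    rw [hr]; field_simp; simp
  rw [← h4] at h5
  exact hd (leadingCoeff_eq_zero.1 h5)

open Polynomial in
/-- If the second derivative of the rational function `P / Q` vanishes, then `P / Q` is affine,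
provided the characteristic is large. -/
theorem exists_eq_affine_mul_of_second_derivative_eq_zero {K : Type*} [Field K] {d : ℕ}
    (hM : ∀ j : ℕ, 0 < j → j ≤ 2 * d + 1 → (j : K) ≠ 0) {P Q : K[X]} (hQ : Q ≠ 0)
    (hPd : P.natDegree ≤ d) (hQd : Q.natDegree ≤ d)
    (h : derivative (derivative P) * Q ^ 2 - 2 * derivative P * derivative Q * Q
      - P * derivative (derivative Q) * Q + 2 * P * derivative Q ^ 2 = 0) :
    ∃ r s : K, P = (C r * X + C s) * Q := by
  have hder : ∀ q : K[X], q.natDegree ≤ d → (derivative q).natDegree ≤ d := fun q hq =>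
    (natDegree_derivative_le q).trans (by omega)
  obtain ⟨r, hr⟩ := exists_eq_C_mul_of_derivative_mul_eq hM
    (f := derivative P * Q - P * derivative Q) (g := Q ^ 2) (pow_ne_zero 2 hQ)
    (natDegree_pow_le.trans (by omega))
    ((natDegree_sub_le _ _).trans (max_le
      (natDegree_mul_le.trans (by have := hder P hPd; omega))
      (natDegree_mul_le.trans (by have := hder Q hQd; omega))))
    (by
      simp only [derivative_sub, derivative_mul, derivative_pow]
      simp only [Nat.cast_ofNat, map_ofNat]
      linear_combination Q * h)
  obtain ⟨s, hs⟩ := exists_eq_C_mul_of_derivative_mul_eq hM (f := P - C r * X * Q) (g := Q) hQ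
    (by omega)
    ((natDegree_sub_le _ _).trans (max_le (by omega)
      (natDegree_mul_le.trans (by
        have : (C r * X).natDegree ≤ 1 := by compute_degree
        omega))))
    (by
      simp only [derivative_sub, derivative_mul, derivative_C, derivative_X]
      linear_combination hr)
  exact ⟨r, s, by linear_combination hs⟩

/-- Restriction of a trivariate polynomial to the line `t ↦ t • e + q`. -/
noncomputable def lineRestrict {K : Type*} [Field K] (e q : Fin 3 → K) :
    MvPolynomial (Fin 3) K →ₐ[K] Polynomial K :=
  MvPolynomial.aeval fun i => Polynomial.C (e i) * Polynomial.X + Polynomial.C (q i)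

theorem natDegree_lineRestrict_le {K : Type*} [Field K] (e q : Fin 3 → K)
    (G : MvPolynomial (Fin 3) K) {d : ℕ} (hd : G.totalDegree ≤ d) :
    (lineRestrict e q G).natDegree ≤ d := by
  have := MvPolynomial.aeval_natDegree_le (n := 1) G hd
    (fun i => Polynomial.C (e i) * Polynomial.X + Polynomial.C (q i))
    (fun i => by compute_degree)
  simpa [lineRestrict] using this

theorem eval_lineRestrict {K : Type*} [Field K] (e q : Fin 3 → K)
    (G : MvPolynomial (Fin 3) K) (t : K) :
    (lineRestrict e q G).eval t = MvPolynomial.eval (fun i => e i * t + q i) G := by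
  induction G using MvPolynomial.induction_on with
  | C a => simp [lineRestrict]
  | add p r hp hr => simp [hp, hr]
  | mul_X p i hp => simp only [map_mul, Polynomial.eval_mul, hp]; simp [lineRestrict]

theorem derivative_lineRestrict {K : Type*} [Field K] (e q : Fin 3 → K)
    (G : MvPolynomial (Fin 3) K) :
    Polynomial.derivative (lineRestrict e q G) =
      Polynomial.C (e 0) * lineRestrict e q (MvPolynomial.pderiv 0 G)
        + Polynomial.C (e 1) * lineRestrict e q (MvPolynomial.pderiv 1 G)
        + Polynomial.C (e 2) * lineRestrict e q (MvPolynomial.pderiv 2 G) := by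
  induction G using MvPolynomial.induction_on with
  | C a => simp [lineRestrict]
  | add p r hp hr => simp only [map_add, hp, hr]; ring
  | mul_X p i hp =>
    have hX : lineRestrict e q (MvPolynomial.X i) =
        Polynomial.C (e i) * Polynomial.X + Polynomial.C (q i) := by simp [lineRestrict]
    simp only [map_mul, Polynomial.derivative_mul, hp, MvPolynomial.pderiv_mul, hX, map_add]
    fin_cases i <;> simp [MvPolynomial.pderiv_X] <;> ring

theorem MvPolynomial.pderiv_comm {K σ : Type*} [CommRing K] (i j : σ) (G : MvPolynomial σ K) :
    pderiv i (pderiv j G) = pderiv j (pderiv i G) := by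
  ext m
  simp only [coeff_pderiv, Finsupp.add_apply]
  rw [add_right_comm]
  by_cases h : i = j
  · subst h; ring
  · rw [Finsupp.single_eq_of_ne h, Finsupp.single_eq_of_ne (Ne.symm h)]
    push_cast; ring

theorem MvPolynomial.totalDegree_pderiv_lt {K σ : Type*} [CommRing K] (i : σ)
    (G : MvPolynomial σ K) (h : pderiv i G ≠ 0) :
    (pderiv i G).totalDegree < G.totalDegree := by
  obtain ⟨m, hm, hmd⟩ : ∃ m ∈ (pderiv i G).support,
      (pderiv i G).totalDegree = m.sum fun _ k => k :=
    Finset.exists_mem_eq_sup _ (support_nonempty.2 h) _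
  rw [hmd]
  have hm' : m + Finsupp.single i 1 ∈ G.support := by
    rw [mem_support_iff] at hm ⊢
    rw [coeff_pderiv] at hm
    exact left_ne_zero_of_mul hm
  have := le_totalDegree hm'
  rw [Finsupp.sum_add_index' (by simp) (by simp), Finsupp.sum_single_index rfl] at this
  omega

theorem MvPolynomial.totalDegree_pderiv_le {K σ : Type*} [CommRing K] (i : σ)
    (G : MvPolynomial σ K) {d : ℕ} (hd : G.totalDegree ≤ d) :
    (pderiv i G).totalDegree ≤ d := by
  by_cases h : pderiv i G = 0
  · simp [h]
  · exact (totalDegree_pderiv_lt i G h).le.trans hd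

/-- A polynomial of degree below the characteristic all of whose partial derivatives vanish
is constant. -/
theorem MvPolynomial.eq_C_of_pderiv_eq_zero {K σ : Type*} [Field K] {d : ℕ}
    (hK : ∀ j : ℕ, 0 < j → j ≤ d → (j : K) ≠ 0) (G : MvPolynomial σ K)
    (hd : G.totalDegree ≤ d) (h : ∀ i, pderiv i G = 0) : G = C (coeff 0 G) := by
  ext m
  rw [coeff_C]
  split_ifs with hm
  · rw [← hm]
  by_contra hne
  obtain ⟨i, hi⟩ : ∃ i, m i ≠ 0 := by
    by_contra hcon
    push Not at hcon
    exact hm (Finsupp.ext hcon).symm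
  have hle : Finsupp.single i 1 ≤ m := by simpa using Nat.one_le_iff_ne_zero.2 hi
  have h1 := coeff_pderiv (i := i) G (m - Finsupp.single i 1)
  rw [h i, tsub_add_cancel_of_le hle, coeff_zero] at h1
  have h2 : m i ≤ d := by
    have h3 := le_totalDegree (mem_support_iff.2 hne)
    have h4 : m i ≤ m.sum fun _ k => k := by
      rw [Finsupp.sum]
      exact Finset.single_le_sum (f := fun j => m j) (fun _ _ => Nat.zero_le _)
        (Finsupp.mem_support_iff.2 hi)
    omega
  have h5 : (((m - Finsupp.single i 1 : σ →₀ ℕ) i : ℕ) : K) + 1 = (m i : K) := by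
    rw [Finsupp.tsub_apply, Finsupp.single_eq_same, ← Nat.cast_succ,
      Nat.succ_eq_add_one, Nat.sub_add_cancel (Nat.one_le_iff_ne_zero.2 hi)]
  rw [h5] at h1
  exact mul_ne_zero hne (hK _ (Nat.pos_of_ne_zero hi) h2) h1.symm

/-- Interpolation: a nonzero polynomial of low degree vanishing on prescribed lines. -/
theorem exists_ne_zero_lineRestrict_eq_zero {K ι : Type*} [Field K] [Fintype ι]
    (e q : ι → Fin 3 → K) {D : ℕ} (hD : Fintype.card ι * (3 * D + 1) < D ^ 3) :
    ∃ G : MvPolynomial (Fin 3) K, G ≠ 0 ∧ G.totalDegree ≤ 3 * D ∧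
      ∀ i, lineRestrict (e i) (q i) G = 0 := by
  let mon : (Fin 3 → Fin D) → (Fin 3 →₀ ℕ) := fun s => Finsupp.equivFunOnFinite.symm fun i => s i
  have hmon : Function.Injective mon := by
    intro s t h
    funext i
    have := DFunLike.congr_fun h i
    exact Fin.ext this
  let T : ((Fin 3 → Fin D) → K) →ₗ[K] MvPolynomial (Fin 3) K :=
    Fintype.linearCombination K fun s => MvPolynomial.monomial (mon s) (1 : K)
  have hT : ∀ f, T f = ∑ s, MvPolynomial.monomial (mon s) (f s) := by
    intro f
    simp [T, Fintype.linearCombination_apply, MvPolynomial.smul_monomial]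
  have hTc : ∀ f s, MvPolynomial.coeff (mon s) (T f) = f s := by
    intro f s
    rw [hT, MvPolynomial.coeff_sum, Finset.sum_eq_single s]
    · simp
    · intro t _ hts
      rw [MvPolynomial.coeff_monomial, if_neg (fun h => hts (hmon h))]
    · simp
  have hTd : ∀ f, (T f).totalDegree ≤ 3 * D := by
    intro f
    rw [hT]
    refine MvPolynomial.totalDegree_finsetSum_le fun s _ => ?_
    refine (MvPolynomial.totalDegree_monomial_le _ _).trans ?_
    rw [Finsupp.sum_fintype _ _ (by simp)]
    refine (Finset.sum_le_card_nsmul _ _ D fun i _ => (s i).2.le).trans ?_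
    simp
  let Φ : ((Fin 3 → Fin D) → K) →ₗ[K] (ι → Fin (3 * D + 1) → K) :=
    LinearMap.pi fun i => LinearMap.pi fun k =>
      (Polynomial.lcoeff K k).comp ((lineRestrict (e i) (q i)).toLinearMap.comp T)
  have hlt : Module.finrank K (ι → Fin (3 * D + 1) → K) <
      Module.finrank K ((Fin 3 → Fin D) → K) := by
    simpa [Module.finrank_pi_fintype] using hD
  obtain ⟨f, hf, hf0⟩ := (Submodule.ne_bot_iff _).1 (LinearMap.ker_ne_bot_of_finrank_lt (f := Φ) hlt)
  refine ⟨T f, ?_, hTd f, ?_⟩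
  · intro h
    apply hf0
    funext s
    rw [← hTc f s, h]; simp
  · intro i
    have hdeg := natDegree_lineRestrict_le (e i) (q i) (T f) (hTd f)
    ext k
    by_cases hk : k < 3 * D + 1
    · exact congrFun (congrFun (LinearMap.mem_ker.1 hf) i) ⟨k, hk⟩
    · exact Polynomial.coeff_eq_zero_of_natDegree_lt (by omega)

theorem Polynomial.eq_zero_of_natDegree_lt_card_of_injOn {K ι : Type*} [Field K]
    {f : Polynomial K} {d : ℕ} (hf : f.natDegree ≤ d) {T : Finset ι} {g : ι → K}
    (hg : Set.InjOn g T) (h0 : ∀ i ∈ T, f.eval (g i) = 0) (hT : d < T.card) : f = 0 := by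
  refine Polynomial.eq_zero_of_natDegree_lt_card_of_eval_eq_zero' f (T.image g) ?_ ?_
  · simpa using h0
  · rw [Finset.card_image_of_injOn hg]; omega

/-- The pulled-back condition that `G` has contact of order two with the line cut out of its tangent
plane by a plane parallel to the first and third coordinate axes. -/
noncomputable def contactPolynomial {K : Type*} [Field K] (i : Fin 3) (G : MvPolynomial (Fin 3) K) :
    MvPolynomial (Fin 3) K :=
  MvPolynomial.pderiv i (MvPolynomial.pderiv i G) * (MvPolynomial.pderiv 2 G) ^ 2
    - 2 * MvPolynomial.pderiv i (MvPolynomial.pderiv 2 G) * MvPolynomial.pderiv i G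
      * MvPolynomial.pderiv 2 G
    + MvPolynomial.pderiv 2 (MvPolynomial.pderiv 2 G) * (MvPolynomial.pderiv i G) ^ 2

theorem totalDegree_contactPolynomial_le {K : Type*} [Field K] (i : Fin 3)
    (G : MvPolynomial (Fin 3) K) {d : ℕ} (hd : G.totalDegree ≤ d) :
    (contactPolynomial i G).totalDegree ≤ 3 * d := by
  have h1 : ∀ j, (MvPolynomial.pderiv j G).totalDegree ≤ d := fun j =>
    MvPolynomial.totalDegree_pderiv_le j G hd
  have h2 : ∀ j k, (MvPolynomial.pderiv j (MvPolynomial.pderiv k G)).totalDegree ≤ d := fun j k =>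
    MvPolynomial.totalDegree_pderiv_le j _ (h1 k)
  have hmul : ∀ A B C : MvPolynomial (Fin 3) K, A.totalDegree ≤ d → B.totalDegree ≤ d →
      C.totalDegree ≤ d → (A * B * C).totalDegree ≤ 3 * d := by
    intro A B C hA hB hC
    have := MvPolynomial.totalDegree_mul (A * B) C
    have := MvPolynomial.totalDegree_mul A B
    omega
  have h2' : ∀ A : MvPolynomial (Fin 3) K, A.totalDegree ≤ d → (2 * A).totalDegree ≤ d := by
    intro A hA
    rw [two_mul]
    exact (MvPolynomial.totalDegree_add _ _).trans (by simpa using hA)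
  unfold contactPolynomial
  refine (MvPolynomial.totalDegree_add _ _).trans (max_le ?_ ?_)
  · refine (MvPolynomial.totalDegree_sub _ _).trans (max_le ?_ ?_)
    · rw [pow_two, ← mul_assoc]
      exact hmul _ _ _ (h2 _ _) (h1 _) (h1 _)
    · exact hmul _ _ _ (h2' _ (h2 _ _)) (h1 _) (h1 _)
  · rw [pow_two, ← mul_assoc]
    exact hmul _ _ _ (h2 _ _) (h1 _) (h1 _)

set_option maxHeartbeats 2000000 in
/-- Two families of lines in space, the members of the first lying in distinct planes `x = b i`
and those of the second in distinct planes `y = u j`. If all of them lie on a surface of degree at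
most `d` and each meets more than `3 * d` lines of the other family, then some line of the second
family meets, with at most `d` exceptions, only lines of a single regulus. -/
theorem exists_regulus_of_lineRestrict_eq_zero {K ι κ : Type*} [Field K] {R : Finset ι}
    {S : Finset κ} {a b c : ι → K} {u v w : κ → K} (hb : Set.InjOn b R) (hu : Set.InjOn u S)
    {E : ι → κ → Prop}
    (hE : ∀ i ∈ R, ∀ j ∈ S, E i j → a i * u j + c i = v j * b i + w j) {d : ℕ}
    (hK : ∀ j : ℕ, 0 < j → j ≤ 2 * d + 1 → (j : K) ≠ 0)
    (hRdeg : ∀ i ∈ R, 3 * d < (S.filter fun j => E i j).card)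
    (hSdeg : ∀ j ∈ S, 3 * d < (R.filter fun i => E i j).card)
    (hR : R.Nonempty)
    (hG : ∃ G : MvPolynomial (Fin 3) K, G ≠ 0 ∧ G.totalDegree ≤ d ∧
      (∀ i ∈ R, lineRestrict ![0, 1, a i] ![b i, 0, c i] G = 0) ∧
      ∀ j ∈ S, lineRestrict ![1, 0, v j] ![0, u j, w j] G = 0) :
    ∃ j ∈ S, ∃ r s r' s' : K, (R.filter fun i => E i j).card ≤
      (R.filter fun i => E i j ∧ a i = r * b i + s ∧ c i = r' * b i + s').card + d := by
  set red : ι → MvPolynomial (Fin 3) K →ₐ[K] Polynomial K :=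
    fun i => lineRestrict ![0, 1, a i] ![b i, 0, c i] with hred
  set blue : κ → MvPolynomial (Fin 3) K →ₐ[K] Polynomial K :=
    fun j => lineRestrict ![1, 0, v j] ![0, u j, w j] with hblue
  have red_eval : ∀ i G t, (red i G).eval t =
      MvPolynomial.eval ![b i, t, a i * t + c i] G := by
    intro i G t
    rw [hred, eval_lineRestrict]
    congr 2
    funext k
    fin_cases k <;> simp
  have blue_eval : ∀ j G t, (blue j G).eval t =
      MvPolynomial.eval ![t, u j, v j * t + w j] G := by
    intro i G t
    rw [hblue, eval_lineRestrict]
    congr 2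
    funext k
    fin_cases k <;> simp
  have red_der : ∀ i G, Polynomial.derivative (red i G) = red i (MvPolynomial.pderiv 1 G)
      + Polynomial.C (a i) * red i (MvPolynomial.pderiv 2 G) := by
    intro i G
    simp [hred, derivative_lineRestrict]
  have blue_der : ∀ j G, Polynomial.derivative (blue j G) = blue j (MvPolynomial.pderiv 0 G)
      + Polynomial.C (v j) * blue j (MvPolynomial.pderiv 2 G) := by
    intro i G
    simp [hblue, derivative_lineRestrict]
  have meet : ∀ i ∈ R, ∀ j ∈ S, E i j → ∀ G, (red i G).eval (u j) = (blue j G).eval (b i) := by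
    intro i hi j hj hij G
    rw [red_eval, blue_eval, hE i hi j hj hij]
  have to_blue : ∀ G : MvPolynomial (Fin 3) K, G.totalDegree ≤ 3 * d →
      (∀ i ∈ R, red i G = 0) → ∀ j ∈ S, blue j G = 0 := by
    intro G hGd h j hj
    refine Polynomial.eq_zero_of_natDegree_lt_card_of_injOn
      (natDegree_lineRestrict_le _ _ G hGd) (T := R.filter fun i => E i j) (g := b)
      (hb.mono (Finset.coe_subset.2 (Finset.filter_subset _ _))) ?_ (hSdeg j hj)
    intro i hi
    obtain ⟨hi, hij⟩ := Finset.mem_filter.1 hi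
    rw [← meet i hi j hj hij, h i hi, Polynomial.eval_zero]
  have to_red : ∀ G : MvPolynomial (Fin 3) K, G.totalDegree ≤ 3 * d →
      (∀ j ∈ S, blue j G = 0) → ∀ i ∈ R, red i G = 0 := by
    intro G hGd h i hi
    refine Polynomial.eq_zero_of_natDegree_lt_card_of_injOn
      (natDegree_lineRestrict_le _ _ G hGd) (T := S.filter fun j => E i j) (g := u)
      (hu.mono (Finset.coe_subset.2 (Finset.filter_subset _ _))) ?_ (hRdeg i hi)
    intro j hj
    obtain ⟨hj, hij⟩ := Finset.mem_filter.1 hj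
    rw [meet i hi j hj hij, h j hj, Polynomial.eval_zero]
  obtain ⟨G, ⟨hG0, hGd, hGR, hGS⟩, hmin⟩ : ∃ G : MvPolynomial (Fin 3) K,
      (G ≠ 0 ∧ G.totalDegree ≤ d ∧ (∀ i ∈ R, red i G = 0) ∧ ∀ j ∈ S, blue j G = 0) ∧
      ∀ H : MvPolynomial (Fin 3) K, H.totalDegree < G.totalDegree →
        (∀ i ∈ R, red i H = 0) → (∀ j ∈ S, blue j H = 0) → H = 0 := by
    have hex : ∃ k, ∃ G : MvPolynomial (Fin 3) K, (G ≠ 0 ∧ G.totalDegree ≤ d ∧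
        (∀ i ∈ R, red i G = 0) ∧ ∀ j ∈ S, blue j G = 0) ∧ G.totalDegree = k := by
      obtain ⟨G, hG⟩ := hG
      exact ⟨_, G, hG, rfl⟩
    obtain ⟨G, hG, hk⟩ := Nat.find_spec hex
    refine ⟨G, hG, fun H hH h1 h2 => ?_⟩
    by_contra h0
    exact Nat.find_min hex (hk ▸ hH) ⟨H, ⟨h0, hH.le.trans hG.2.1, h1, h2⟩, rfl⟩
  have hd1 : ∀ k, (MvPolynomial.pderiv k G).totalDegree ≤ d := fun k =>
    MvPolynomial.totalDegree_pderiv_le k G hGd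
  have pderiv_zero : ∀ k, (∀ i ∈ R, red i (MvPolynomial.pderiv k G) = 0) →
      (∀ j ∈ S, blue j (MvPolynomial.pderiv k G) = 0) → MvPolynomial.pderiv k G = 0 := by
    intro k h1 h2
    by_contra h0
    exact h0 (hmin _ (MvPolynomial.totalDegree_pderiv_lt k G h0) h1 h2)
  obtain ⟨j, hj, hQ⟩ : ∃ j ∈ S, blue j (MvPolynomial.pderiv 2 G) ≠ 0 := by
    by_contra! hcon
    have hy := pderiv_zero 2 (to_red _ ((hd1 2).trans (by omega)) hcon) hcon
    have hz : MvPolynomial.pderiv 1 G = 0 := by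
      have h1 : ∀ i ∈ R, red i (MvPolynomial.pderiv 1 G) = 0 := by
        intro i hi
        have := red_der i G
        rw [hGR i hi, hy] at this
        simpa using this.symm
      exact pderiv_zero 1 h1 (to_blue _ ((hd1 1).trans (by omega)) h1)
    have hw : MvPolynomial.pderiv 0 G = 0 := by
      have h1 : ∀ j ∈ S, blue j (MvPolynomial.pderiv 0 G) = 0 := by
        intro i hi
        have := blue_der i G
        rw [hGS i hi, hy] at this
        simpa using this.symm
      exact pderiv_zero 0 (to_red _ ((hd1 0).trans (by omega)) h1) h1
    have hconst := MvPolynomial.eq_C_of_pderiv_eq_zero (d := d)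
      (fun k h1 h2 => hK k h1 (by omega)) G hGd
      (fun i => by fin_cases i; exacts [hw, hz, hy])
    obtain ⟨i, hi⟩ := hR
    have h2 := hGR i hi
    rw [hconst] at h2
    have h3 : MvPolynomial.coeff 0 G = 0 := by simpa [hred, lineRestrict] using h2
    rw [h3, map_zero] at hconst
    exact hG0 hconst
  have hcontact_blue : ∀ j ∈ S, blue j (contactPolynomial 0 G) = 0 := by
    intro j hj
    have e1 := blue_der j G
    have e2 := congrArg Polynomial.derivative e1
    rw [hGS j hj] at e1 e2
    simp only [Polynomial.derivative_zero, map_add, Polynomial.derivative_C_mul, blue_der] at e1 e2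
    rw [MvPolynomial.pderiv_comm 2 0] at e2
    simp only [contactPolynomial, map_add, map_sub, map_mul, map_pow, map_ofNat]
    set g0 := blue j (MvPolynomial.pderiv 0 G)
    have : g0 = - Polynomial.C (v j) * blue j (MvPolynomial.pderiv 2 G) := by
      linear_combination -e1
    rw [this]
    linear_combination -(blue j (MvPolynomial.pderiv 2 G)) ^ 2 * e2
  have hcontact_red : ∀ i ∈ R, red i (contactPolynomial 0 G) = 0 :=
    to_red _ (totalDegree_contactPolynomial_le 0 G hGd) hcontact_blue
  have hTinj : Set.InjOn b (R.filter fun i => E i j) :=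
    hb.mono (Finset.coe_subset.2 (Finset.filter_subset _ _))
  have rel : ∀ i ∈ R, E i j →
      (blue j (MvPolynomial.pderiv 1 G)).eval (b i)
        + a i * (blue j (MvPolynomial.pderiv 2 G)).eval (b i) = 0 := by
    intro i hi hij
    have e1 := congrArg (Polynomial.eval (u j)) (red_der i G)
    rw [hGR i hi] at e1
    simpa [meet i hi j hj hij] using e1.symm
  obtain ⟨r, s, hrs⟩ := exists_eq_affine_mul_of_second_derivative_eq_zero (d := d) hK
    (P := - blue j (MvPolynomial.pderiv 1 G)) (Q := blue j (MvPolynomial.pderiv 2 G)) hQ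
    (by rw [Polynomial.natDegree_neg]; exact natDegree_lineRestrict_le _ _ _ (hd1 1))
    (natDegree_lineRestrict_le _ _ _ (hd1 2)) (by
      refine Polynomial.eq_zero_of_natDegree_lt_card_of_injOn (d := 3 * d) ?_ hTinj ?_ (hSdeg j hj)
      · have hP := natDegree_lineRestrict_le ![1, 0, v j] ![0, u j, w j] _ (hd1 1)
        have hQd := natDegree_lineRestrict_le ![1, 0, v j] ![0, u j, w j] _ (hd1 2)
        have hder : ∀ f : Polynomial K, f.natDegree ≤ d → (Polynomial.derivative f).natDegree ≤ d :=
          fun f hf => (Polynomial.natDegree_derivative_le f).trans (by omega)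
        have h3 : ∀ f g h : Polynomial K, f.natDegree ≤ d → g.natDegree ≤ d → h.natDegree ≤ d →
            (f * g * h).natDegree ≤ 3 * d := by
          intro f g h hf hg hh
          have h1 := Polynomial.natDegree_mul_le (p := f * g) (q := h)
          have h2 := Polynomial.natDegree_mul_le (p := f) (q := g)
          omega
        have h2 : ∀ f : Polynomial K, f.natDegree ≤ d → (2 * f).natDegree ≤ d := by
          intro f hf
          rw [two_mul]
          exact Polynomial.natDegree_add_le_of_degree_le hf hf
        have hP' : (-blue j (MvPolynomial.pderiv 1 G)).natDegree ≤ d := by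
          rwa [Polynomial.natDegree_neg]
        have hs : ∀ f g : Polynomial K, f.natDegree ≤ 3 * d → g.natDegree ≤ 3 * d →
            (f - g).natDegree ≤ 3 * d := fun f g hf hg =>
          (Polynomial.natDegree_sub_le_of_le hf hg).trans (max_self _).le
        refine Polynomial.natDegree_add_le_of_degree_le (hs _ _ (hs _ _ ?_ ?_) ?_) ?_
        · rw [pow_two, ← mul_assoc]
          exact h3 _ _ _ (hder _ (hder _ hP')) hQd hQd
        · exact h3 _ _ _ (h2 _ (hder _ hP')) (hder _ hQd) hQd
        · exact h3 _ _ _ hP' (hder _ (hder _ hQd)) hQd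
        · rw [pow_two, ← mul_assoc]
          exact h3 _ _ _ (h2 _ hP') (hder _ hQd) (hder _ hQd)
      · intro i hi
        obtain ⟨hi, hij⟩ := Finset.mem_filter.1 hi
        have e1 := blue_der j G
        have e2 := congrArg Polynomial.derivative e1
        rw [hGS j hj] at e1 e2
        have e3 := red_der i (contactPolynomial 0 G)
        rw [hcontact_red i hi] at e3
        have e4 := rel i hi hij
        replace e1 := congrArg (Polynomial.eval (b i)) e1
        replace e2 := congrArg (Polynomial.eval (b i)) e2
        replace e3 := congrArg (Polynomial.eval (u j)) e3
        have n1 := MvPolynomial.pderiv_comm 1 0 G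
        have n2 := MvPolynomial.pderiv_comm 2 0 G
        have n3 := MvPolynomial.pderiv_comm 2 1 G
        have n4 := fun k => MvPolynomial.pderiv_comm 1 0 (MvPolynomial.pderiv k G)
        have n5 := fun k => MvPolynomial.pderiv_comm 2 0 (MvPolynomial.pderiv k G)
        have n6 := fun k => MvPolynomial.pderiv_comm 2 1 (MvPolynomial.pderiv k G)
        have n7 : ∀ k : Fin 3, MvPolynomial.pderiv k (2 : MvPolynomial (Fin 3) K) = 0 := fun k => by
          exact_mod_cast Derivation.map_natCast (MvPolynomial.pderiv k) 2
        simp only [contactPolynomial, map_add, map_sub, map_mul, map_pow, map_ofNat,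
          Polynomial.derivative_zero, Polynomial.derivative_C_mul, blue_der, Polynomial.eval_add,
          Polynomial.eval_sub, Polynomial.eval_mul, Polynomial.eval_C, Polynomial.eval_zero,
          Polynomial.eval_pow, Polynomial.eval_neg, Polynomial.derivative_neg,
          meet i hi j hj hij, Derivation.leibniz, Derivation.leibniz_pow, smul_eq_mul,
          n1, n2, n3, n4, n5, n6, nsmul_eq_mul, Polynomial.eval_ofNat, Nat.cast_ofNat,
          n7, mul_zero, add_zero, Nat.add_one_sub_one, pow_one,
          Polynomial.eval_ofNat] at e1 e2 e3 e4 ⊢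
        generalize Polynomial.eval (b i) (blue j (MvPolynomial.pderiv 0 G)) = g0 at *
        generalize Polynomial.eval (b i) (blue j (MvPolynomial.pderiv 1 G)) = g1 at *
        generalize Polynomial.eval (b i) (blue j (MvPolynomial.pderiv 2 G)) = g2 at *
        generalize Polynomial.eval (b i) (blue j (MvPolynomial.pderiv 0 (MvPolynomial.pderiv 0 G))) = g00 at *
        generalize Polynomial.eval (b i) (blue j (MvPolynomial.pderiv 0 (MvPolynomial.pderiv 2 G))) = g02 at *
        obtain rfl : g1 = -(a i * g2) := by linear_combination e4
        obtain rfl : g0 = -(v j * g2) := by linear_combination -e1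
        obtain rfl : g00 = -(2 * v j * g02 + v j ^ 2 * Polynomial.eval (b i) (blue j (MvPolynomial.pderiv 2 (MvPolynomial.pderiv 2 G)))) := by linear_combination -e2
        clear e1 e2 e4
        linear_combination e3)
  refine ⟨j, hj, r, s, v j - u j * r, w j - u j * s, ?_⟩
  have hzero : ((R.filter fun i => E i j).filter fun i =>
      (blue j (MvPolynomial.pderiv 2 G)).eval (b i) = 0).card ≤ d := by
    by_contra hcon
    refine hQ (Polynomial.eq_zero_of_natDegree_lt_card_of_injOn
      (natDegree_lineRestrict_le _ _ _ (hd1 2))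
      (hTinj.mono (Finset.coe_subset.2 (Finset.filter_subset _ _))) ?_ (not_le.1 hcon))
    intro i hi
    exact (Finset.mem_filter.1 hi).2
  rw [← Finset.card_filter_add_card_filter_not
    (s := R.filter fun i => E i j)
    (fun i => (blue j (MvPolynomial.pderiv 2 G)).eval (b i) = 0), add_comm]
  refine Nat.add_le_add (Finset.card_le_card fun i hi => ?_) hzero
  simp only [Finset.mem_filter] at hi ⊢
  obtain ⟨⟨hi, hij⟩, hne⟩ := hi
  have h1 := congrArg (Polynomial.eval (b i)) hrs
  have h2 := rel i hi hij
  simp only [Polynomial.eval_neg, Polynomial.eval_mul, Polynomial.eval_add, Polynomial.eval_C,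
    Polynomial.eval_X] at h1
  have h3 : a i = r * b i + s := by
    apply mul_right_cancel₀ hne
    linear_combination h2 + h1
  refine ⟨hi, hij, h3, ?_⟩
  have h4 := hE i hi j hj hij
  linear_combination h4 - u j * h3

theorem exists_card_filter_le_of_regulus_bound {K ι κ : Type*} [Field K] {R : Finset ι}
    {S : Finset κ} {a b c : ι → K} {u v w : κ → K} (hb : Set.InjOn b R) (hu : Set.InjOn u S)
    {E : ι → κ → Prop}
    (hE : ∀ i ∈ R, ∀ j ∈ S, E i j → a i * u j + c i = v j * b i + w j) {k : ℕ}
    (hk : ∀ j ∈ S, ∀ r s r' s' : K,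
      (R.filter fun i => E i j ∧ a i = r * b i + s ∧ c i = r' * b i + s').card ≤ k)
    {N : ℕ} (hN : R.card + S.card = N) (hN0 : 0 < N)
    (hK : ∀ j : ℕ, 0 < j → (j : ℝ) ≤ 20 * √N → (j : K) ≠ 0) :
    (∃ i ∈ R, ((S.filter fun j => E i j).card : ℝ) ≤ 40 * √N + k) ∨
      ∃ j ∈ S, ((R.filter fun i => E i j).card : ℝ) ≤ 40 * √N + k := by
  by_contra! hcon
  obtain ⟨hR, hS⟩ := hcon
  have hN1 : (1 : ℝ) ≤ √N := Real.one_le_sqrt.2 (by exact_mod_cast hN0)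
  have hsq : √(N : ℝ) * √N = N := Real.mul_self_sqrt (by positivity)
  set D := ⌈2 * √(N : ℝ)⌉₊ with hD
  have hD1 : 2 * √(N : ℝ) ≤ D := Nat.le_ceil _
  have hD2 : (D : ℝ) < 2 * √(N : ℝ) + 1 := Nat.ceil_lt_add_one (by positivity)
  have hRne : R.Nonempty := by
    by_contra h
    rw [Finset.not_nonempty_iff_eq_empty] at h
    subst h
    have : S.Nonempty := by
      rw [← Finset.card_pos]; simpa [← hN] using hN0
    obtain ⟨j, hj⟩ := this
    have := hS j hj
    simp only [Finset.filter_empty, Finset.card_empty, Nat.cast_zero] at this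
    have : (0 : ℝ) ≤ k := by positivity
    linarith
  have hDN : Fintype.card (R ⊕ S) * (3 * D + 1) < D ^ 3 := by
    rw [Fintype.card_sum, Fintype.card_coe, Fintype.card_coe, hN]
    have : (N : ℝ) * (3 * D + 1) < (D : ℝ) ^ 3 := by
      have h4 : 4 * (N : ℝ) ≤ (D : ℝ) ^ 2 := by nlinarith
      have hNp : (0 : ℝ) < N := by exact_mod_cast hN0
      nlinarith
    exact_mod_cast this
  obtain ⟨G, hG0, hGd, hG⟩ := exists_ne_zero_lineRestrict_eq_zero
    (Sum.elim (fun i : R => ![0, 1, a i]) (fun j : S => ![1, 0, v j]))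
    (Sum.elim (fun i : R => ![b i, 0, c i]) (fun j : S => ![0, u j, w j])) hDN
  have hk0 : (0 : ℝ) ≤ k := by positivity
  obtain ⟨j, hj, r, s, r', s', h⟩ := exists_regulus_of_lineRestrict_eq_zero hb hu hE (d := 3 * D)
    (fun j h1 h2 => hK j h1 (by
      have : (j : ℝ) ≤ 2 * (3 * D) + 1 := by exact_mod_cast h2
      linarith))
    (fun i hi => by
      have : ((3 * (3 * D) : ℕ) : ℝ) < (S.filter fun j => E i j).card := by
        push_cast
        linarith [hR i hi]
      exact_mod_cast this)
    (fun i hi => by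
      have : ((3 * (3 * D) : ℕ) : ℝ) < (R.filter fun j => E j i).card := by
        push_cast
        linarith [hS i hi]
      exact_mod_cast this)
    hRne ⟨G, hG0, hGd, fun i hi => hG (Sum.inl ⟨i, hi⟩), fun j hj => hG (Sum.inr ⟨j, hj⟩)⟩
  have h1 := h.trans (Nat.add_le_add_right (hk j hj r s r' s') _)
  have h2 : ((R.filter fun i => E i j).card : ℝ) ≤ k + 3 * D := by exact_mod_cast h1
  linarith [hS j hj]

/-- Edges between two families of lines in space in distinct planes parallel to coordinate planes
are rare, if no line of the second family meets many lines of a regulus. -/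
theorem card_filter_product_le_of_regulus_bound {K ι κ : Type*} [Field K]
    {a b c : ι → K} {u v w : κ → K} {E : ι → κ → Prop} {k : ℕ} (N : ℕ)
    (hK : ∀ j : ℕ, 0 < j → (j : ℝ) ≤ 20 * √N → (j : K) ≠ 0) (R : Finset ι) (S : Finset κ)
    (hN : R.card + S.card = N) (hb : Set.InjOn b R) (hu : Set.InjOn u S)
    (hE : ∀ i ∈ R, ∀ j ∈ S, E i j → a i * u j + c i = v j * b i + w j)
    (hk : ∀ j ∈ S, ∀ r s r' s' : K,
      (R.filter fun i => E i j ∧ a i = r * b i + s ∧ c i = r' * b i + s').card ≤ k) :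
    (((R ×ˢ S).filter fun x => E x.1 x.2).card : ℝ) ≤ 40 * (N * √N) + k * N := by
  induction N generalizing R S with
  | zero =>
    have hR : R = ∅ := by rw [← Finset.card_eq_zero]; omega
    simp [hR]
  | succ N ih =>
    have hmono : √(N : ℝ) ≤ √((N + 1 : ℕ) : ℝ) := Real.sqrt_le_sqrt (by push_cast; linarith)
    have hK' : ∀ j : ℕ, 0 < j → (j : ℝ) ≤ 20 * √N → (j : K) ≠ 0 := fun j h1 h2 =>
      hK j h1 (by linarith)
    have hN0 : (0 : ℝ) ≤ N := by positivity
    have hstep : 40 * ((N : ℝ) * √N) + k * N + (40 * √((N + 1 : ℕ) : ℝ) + k)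
        ≤ 40 * (((N + 1 : ℕ) : ℝ) * √((N + 1 : ℕ) : ℝ)) + k * ((N + 1 : ℕ) : ℝ) := by
      have := mul_le_mul_of_nonneg_left hmono hN0
      push_cast at *
      linarith
    rcases exists_card_filter_le_of_regulus_bound hb hu hE hk hN (Nat.succ_pos _) hK with
      ⟨i, hi, h⟩ | ⟨j, hj, h⟩
    · have hc : (R.erase i).card + S.card = N := by
        rw [Finset.card_erase_of_mem hi]
        have := Finset.card_pos.2 ⟨i, hi⟩
        omega
      have h1 := ih hK' (R.erase i) S hc
        (hb.mono (Finset.coe_subset.2 (Finset.erase_subset _ _))) hu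
        (fun i' hi' => hE i' (Finset.mem_of_mem_erase hi'))
        (fun j hj r s r' s' => (Finset.card_le_card (Finset.filter_subset_filter _
          (Finset.erase_subset _ _))).trans (hk j hj r s r' s'))
      have h2 : ((R ×ˢ S).filter fun x => E x.1 x.2).card ≤
          (((R.erase i) ×ˢ S).filter fun x => E x.1 x.2).card
            + (S.filter fun j => E i j).card := by
        rw [← Finset.card_image_of_injective (S.filter fun j => E i j) (Prod.mk_right_injective i)]
        refine (Finset.card_le_card fun x hx => ?_).trans (Finset.card_union_le _ _)
        by_cases hxi : x.1 = i <;>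
          simp_all [Finset.mem_filter, Finset.mem_product, Prod.ext_iff]
      have h2' : (((R ×ˢ S).filter fun x => E x.1 x.2).card : ℝ) ≤
          (((R.erase i) ×ˢ S).filter fun x => E x.1 x.2).card
            + (S.filter fun j => E i j).card := by exact_mod_cast h2
      linarith
    · have hc : R.card + (S.erase j).card = N := by
        rw [Finset.card_erase_of_mem hj]
        have := Finset.card_pos.2 ⟨j, hj⟩
        omega
      have h1 := ih hK' R (S.erase j) hc hb
        (hu.mono (Finset.coe_subset.2 (Finset.erase_subset _ _)))
        (fun i' hi' j' hj' => hE i' hi' j' (Finset.mem_of_mem_erase hj'))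
        (fun j hj => hk j (Finset.mem_of_mem_erase hj))
      have h2 : ((R ×ˢ S).filter fun x => E x.1 x.2).card ≤
          ((R ×ˢ (S.erase j)).filter fun x => E x.1 x.2).card
            + (R.filter fun i => E i j).card := by
        rw [← Finset.card_image_of_injective (R.filter fun i => E i j) (Prod.mk_left_injective j)]
        refine (Finset.card_le_card fun x hx => ?_).trans (Finset.card_union_le _ _)
        by_cases hxi : x.2 = j <;>
          simp_all [Finset.mem_filter, Finset.mem_product, Prod.ext_iff]
      have h2' : (((R ×ˢ S).filter fun x => E x.1 x.2).card : ℝ) ≤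
          ((R ×ˢ (S.erase j)).filter fun x => E x.1 x.2).card
            + (R.filter fun i => E i j).card := by exact_mod_cast h2
      linarith

theorem card_sq_le_card_mul_card_filter_eq {α β : Type*} (s : Finset α) (B : Finset β) (f : α → β)
    (hf : ∀ x ∈ s, f x ∈ B) :
    s.card ^ 2 ≤ B.card * ((s ×ˢ s).filter fun x => f x.1 = f x.2).card := by
  have h1 : s.card = ∑ y ∈ B, (s.filter fun x => f x = y).card :=
    Finset.card_eq_sum_card_fiberwise hf
  have h2 : ((s ×ˢ s).filter fun x => f x.1 = f x.2).card
      = ∑ y ∈ B, (s.filter fun x => f x = y).card ^ 2 := by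
    rw [Finset.card_eq_sum_card_fiberwise (f := fun x => f x.1) (t := B)
      (fun x hx => hf _ (Finset.mem_product.1 (Finset.mem_filter.1 hx).1).1)]
    refine Finset.sum_congr rfl fun y _ => ?_
    rw [pow_two, ← Finset.card_product]
    congr 1
    ext x
    simp only [Finset.mem_filter, Finset.mem_product]
    constructor
    · rintro ⟨⟨⟨h1, h2⟩, h3⟩, h4⟩
      exact ⟨⟨h1, h4⟩, h2, h3 ▸ h4⟩
    · rintro ⟨⟨h1, h2⟩, h3, h4⟩
      exact ⟨⟨⟨h1, h3⟩, h2.trans h4.symm⟩, h2⟩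
  rw [h2, h1]
  exact sq_sum_le_card_mul_sum_sq

theorem Polynomial.quartic_coeffs_eq_zero {F : Type*} [Field F] {c0 c1 c2 c3 c4 : F}
    (h : C c4 * X ^ 4 + C c3 * X ^ 3 + C c2 * X ^ 2 + C c1 * X + C c0 = 0) :
    c0 = 0 ∧ c2 = 0 ∧ c3 = 0 ∧ c4 = 0 := by
  have h' : ∀ n, coeff (C c4 * X ^ 4 + C c3 * X ^ 3 + C c2 * X ^ 2 + C c1 * X + C c0) n = 0 := by
    simp [h]
  refine ⟨?_, ?_, ?_, ?_⟩
  · simpa using h' 0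
  · simpa [coeff_X, coeff_C, coeff_X_pow] using h' 2
  · simpa [coeff_X, coeff_C, coeff_X_pow] using h' 3
  · simpa [coeff_X, coeff_C, coeff_X_pow] using h' 4

/-- The number of pairs of incidences at equal height between vertical lines and
nonvertical lines. -/
theorem card_equal_height_pairs_le {F : Type*} [Field F] (A : Finset F) (L : Finset (F × F))
    (J : F → F × F → Prop) {k N : ℕ} (hN : 2 * (A.card * L.card) = N)
    (hF : ∀ j : ℕ, 0 < j → (j : ℝ) ≤ 20 * √N → (j : F) ≠ 0)
    (hk : ∀ a ∈ A, ∀ y, (L.filter fun l => J a l ∧ l.1 * a + l.2 = y).card ≤ k) :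
    ((((A ×ˢ L).filter fun x => J x.1 x.2) ×ˢ ((A ×ˢ L).filter fun x => J x.1 x.2)).filter
      fun x => x.1.2.1 * x.1.1 + x.1.2.2 = x.2.2.1 * x.2.1 + x.2.2.2).card
      ≤ 40 * (N * √N) + (max A.card k : ℕ) * N := by
  let φ := algebraMap (Polynomial F) (RatFunc F)
  have hφ : Function.Injective φ := RatFunc.algebraMap_injective F
  let X2 : F → Polynomial F := fun a => Polynomial.C a + Polynomial.X ^ 2
  let X4 : F × F → Polynomial F := fun l => Polynomial.C l.1 + Polynomial.C l.2 * Polynomial.X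
    + Polynomial.X ^ 4
  let Y3 : F → Polynomial F := fun a => -1 + Polynomial.C a * Polynomial.X
  let Y4 : F × F × F → Polynomial F := fun x => Polynomial.C x.2.2
    - Polynomial.C x.2.1 * Polynomial.X ^ 2 + Polynomial.C x.1 * Polynomial.X ^ 4
  have hX4 : ∀ l, φ (X4 l) ≠ 0 := by
    intro l h
    rw [map_eq_zero_iff φ hφ] at h
    have := congrArg (fun p => Polynomial.coeff p 4) h
    simp [X4] at this
  have hY3 : ∀ a, φ (Y3 a) ≠ 0 := by
    intro a h
    rw [map_eq_zero_iff φ hφ] at h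
    have := congrArg (fun p => Polynomial.coeff p 0) h
    simp [Y3] at this
  let E : F × F × F → F × F × F → Prop := fun i j => J i.1 j.2 ∧ J j.1 i.2 ∧
    j.2.1 * i.1 + j.2.2 = i.2.1 * j.1 + i.2.2
  have key := card_filter_product_le_of_regulus_bound (K := RatFunc F)
    (a := fun i : F × F × F => 1 / φ (X4 i.2)) (b := fun i => φ (X2 i.1) / φ (X4 i.2))
    (c := fun i => φ (Polynomial.C i.2.2) / φ (X4 i.2))
    (u := fun j : F × F × F => φ (Y4 j) / φ (Y3 j.1))
    (v := fun j => - φ (Polynomial.C j.2.1) / φ (Y3 j.1))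
    (w := fun j => φ (Polynomial.C j.1) / φ (Y3 j.1)) (E := E) (k := max A.card k) N
    (by
      intro j h1 h2 h3
      refine hF j h1 h2 ?_
      apply (algebraMap F (RatFunc F)).injective
      simpa using h3) (A ×ˢ L) (A ×ˢ L) (by rw [Finset.card_product]; omega)
    (by
      rintro ⟨a, s, t⟩ _ ⟨a', s', t'⟩ _ h
      simp only at h
      rw [div_eq_div_iff (hX4 _) (hX4 _), ← map_mul, ← map_mul] at h
      have h := hφ h
      obtain ⟨-, h2, h3, h4⟩ := Polynomial.quartic_coeffs_eq_zero (c4 := a - a') (c3 := t' - t)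
        (c2 := s' - s) (c1 := a * t' - a' * t) (c0 := a * s' - a' * s) (by
          simp only [X2, X4] at h
          simp only [map_sub, map_mul]
          linear_combination h)
      rw [sub_eq_zero] at h2 h3 h4
      rw [h2, h3, h4])
    (by
      rintro ⟨a, s, t⟩ _ ⟨a', s', t'⟩ _ h
      simp only at h
      rw [div_eq_div_iff (hY3 _) (hY3 _), ← map_mul, ← map_mul] at h
      have h := hφ h
      obtain ⟨h0, h2, -, h4⟩ := Polynomial.quartic_coeffs_eq_zero (c4 := a' - a)
        (c3 := s' * a - s * a') (c2 := s - s') (c1 := t * a' - t' * a) (c0 := t' - t) (by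
          simp only [Y3, Y4] at h
          simp only [map_sub, map_mul]
          linear_combination h)
      rw [sub_eq_zero] at h0 h2 h4
      rw [h0, h2, h4])
    (by
      rintro ⟨a, s', t'⟩ - ⟨a', s, t⟩ - ⟨-, -, h⟩
      simp only at h ⊢
      have h3 := hY3 a'
      have h4 := hX4 (s', t')
      field_simp
      simp only [← map_mul, ← map_add, ← map_neg]
      congr 1
      simp only [X2, X4, Y3, Y4]
      have h5 := congrArg (Polynomial.C : F →+* Polynomial F) h
      simp only [map_add, map_mul] at h5
      linear_combination h5)
    (by
      rintro ⟨a', s, t⟩ hj r s0 r' s0'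
      have hcard : ∀ T : Finset (F × F × F), (∀ i ∈ T, i.1 ∈ A ∧ i.2 ∈ L ∧ E i (a', s, t) ∧
          1 = r * φ (X2 i.1) + s0 * φ (X4 i.2)) → T.card ≤ max A.card k := by
        intro T hT
        by_cases hs : s0 = 0
        · simp only [hs, zero_mul, add_zero] at hT
          refine le_trans ?_ (le_max_right _ _)
          rcases Finset.eq_empty_or_nonempty T with rfl | ⟨i0, hi0⟩
          · simp
          have hr : r ≠ 0 := by
            rintro rfl
            simpa using (hT i0 hi0).2.2.2
          have hconst : ∀ i ∈ T, i.1 = i0.1 := by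
            intro i hi
            have := hφ (mul_left_cancel₀ hr ((hT i hi).2.2.2.symm.trans (hT i0 hi0).2.2.2))
            exact Polynomial.C_injective (add_right_cancel this)
          refine le_trans (Finset.card_le_card_of_injOn Prod.snd ?_ ?_)
            (hk a' (Finset.mem_product.1 hj).1 (s * i0.1 + t))
          · intro i hi
            have h1 := hconst i hi
            obtain ⟨-, h2, ⟨-, h3, h4⟩, -⟩ := hT i hi
            refine Finset.mem_coe.2 (Finset.mem_filter.2 ⟨h2, h3, ?_⟩)
            rw [← h1]
            exact h4.symm
          · intro i hi i' hi' h
            exact Prod.ext ((hconst i hi).trans (hconst i' hi').symm) h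
        · refine le_trans (Finset.card_le_card_of_injOn Prod.fst ?_ ?_) (le_max_left _ _)
          · intro i hi
            exact (hT i hi).1
          · intro i hi i' hi' h
            have h1 := (hT i hi).2.2.2.symm.trans (hT i' hi').2.2.2
            rw [h] at h1
            have h2 := hφ (mul_left_cancel₀ hs (add_left_cancel h1))
            obtain ⟨-, h4, h5, -⟩ := Polynomial.quartic_coeffs_eq_zero (c4 := 0)
              (c3 := i.2.2 - i'.2.2) (c2 := i.2.1 - i'.2.1) (c1 := 0) (c0 := 0) (by
                simp only [X4] at h2
                simp only [map_sub, map_zero]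
                linear_combination Polynomial.X ^ 2 * h2)
            exact Prod.ext h (Prod.ext (sub_eq_zero.1 h4) (sub_eq_zero.1 h5))
      refine hcard _ fun i hi => ?_
      simp only [Finset.mem_filter, Finset.mem_product] at hi
      obtain ⟨⟨hA, hL⟩, h1, h2, -⟩ := hi
      refine ⟨hA, hL, h1, ?_⟩
      have h4 := hX4 i.2
      field_simp at h2
      linear_combination h2)
  refine le_trans ?_ key
  rw [Nat.cast_le]
  refine Finset.card_le_card_of_injOn (fun x => ((x.1.1, x.2.2), (x.2.1, x.1.2))) ?_ ?_
  · rintro ⟨⟨a, l⟩, ⟨a', l'⟩⟩ hx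
    simp only [E, Finset.coe_filter, Finset.mem_product, Finset.mem_filter, Set.mem_ofPred_eq] at hx ⊢
    tauto
  · rintro ⟨⟨a, l⟩, ⟨a', l'⟩⟩ hx ⟨⟨b, m⟩, ⟨b', m'⟩⟩ hy h
    simp only [Prod.mk.injEq] at h ⊢
    tauto

/-- Incidences between the points of a Cartesian product and nonvertical lines. -/
theorem card_incidences_cartesian_sq_le {F : Type*} [Field F] (A B : Finset F) (L : Finset (F × F))
    (J : F → F × F → Prop) {k N : ℕ} (hN : 2 * (A.card * L.card) = N)
    (hF : ∀ j : ℕ, 0 < j → (j : ℝ) ≤ 20 * √N → (j : F) ≠ 0)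
    (hJ : ∀ a ∈ A, ∀ l ∈ L, J a l → l.1 * a + l.2 ∈ B)
    (hk : ∀ a ∈ A, ∀ y, (L.filter fun l => J a l ∧ l.1 * a + l.2 = y).card ≤ k) :
    (((A ×ˢ L).filter fun x => J x.1 x.2).card : ℝ) ^ 2
      ≤ B.card * (40 * (N * √N) + (max A.card k : ℕ) * N) := by
  have h := card_sq_le_card_mul_card_filter_eq ((A ×ˢ L).filter fun x => J x.1 x.2) B
    (fun x => x.2.1 * x.1 + x.2.2) (by
      intro x hx
      obtain ⟨h1, h2⟩ := Finset.mem_filter.1 hx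
      exact hJ _ (Finset.mem_product.1 h1).1 _ (Finset.mem_product.1 h1).2 h2)
  have h' := (Nat.cast_le (α := ℝ)).2 h
  rw [Nat.cast_mul, Nat.cast_pow] at h'
  exact h'.trans (mul_le_mul_of_nonneg_left (card_equal_height_pairs_le A L J hN hF hk)
    (Nat.cast_nonneg _))

theorem IsLine.eq_of_mem_of_mem {F : Type} [Field F] {ℓ ℓ' : Set (F × F)} (hℓ : IsLine ℓ)
    (hℓ' : IsLine ℓ') {p q : F × F} (hpq : p ≠ q) (hp : p ∈ ℓ) (hq : q ∈ ℓ) (hp' : p ∈ ℓ')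
    (hq' : q ∈ ℓ') : ℓ = ℓ' := by
  have sub : ∀ {ℓ ℓ' : Set (F × F)}, IsLine ℓ → IsLine ℓ' → p ∈ ℓ → q ∈ ℓ → p ∈ ℓ' → q ∈ ℓ' →
      ℓ ⊆ ℓ' := by
    rintro _ _ ⟨α, β, γ, h0, rfl⟩ ⟨α', β', γ', h0', rfl⟩ hp hq hp' hq' z hz
    simp only [Set.mem_ofPred_eq] at *
    have hdet : α * β' - α' * β = 0 := by
      by_contra hd
      apply hpq
      refine Prod.ext (mul_left_cancel₀ hd ?_) (mul_left_cancel₀ hd ?_)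
      · linear_combination β' * (hp - hq) - β * (hp' - hq')
      · linear_combination α * (hp' - hq') - α' * (hp - hq)
    by_cases hα : α = 0
    · have hβ : β ≠ 0 := by
        rintro rfl
        exact h0 (by rw [hα])
      apply mul_left_cancel₀ hβ
      linear_combination β' * (hz - hp) + β * hp' - (z.1 - p.1) * hdet
    · apply mul_left_cancel₀ hα
      linear_combination α' * (hz - hp) + α * hp' + (z.2 - p.2) * hdet
  exact Set.Subset.antisymm (sub hℓ hℓ' hp hq hp' hq') (sub hℓ' hℓ hp' hq' hp hq)

theorem IsLine.eq_of_mem_of_mem_of_ne {F : Type} [Field F] {ℓ ℓ' : Set (F × F)} (hℓ : IsLine ℓ)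
    (hℓ' : IsLine ℓ') {p q : F × F} (hne : ℓ ≠ ℓ') (hp : p ∈ ℓ) (hq : q ∈ ℓ) (hp' : p ∈ ℓ')
    (hq' : q ∈ ℓ') : p = q := by
  by_contra h
  exact hne (hℓ.eq_of_mem_of_mem hℓ' h hp hq hp' hq')

theorem Finset.card_image_le_card_image {α β γ : Type*} (s : Finset α) (f : α → β) (g : α → γ)
    (h : ∀ x ∈ s, ∀ y ∈ s, f x = f y → g x = g y) : (s.image g).card ≤ (s.image f).card := by
  cases isEmpty_or_nonempty α
  · simp [Finset.eq_empty_of_isEmpty s]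
  have : ∀ b ∈ s.image g, ∃ x ∈ s, g x = b := fun b hb => Finset.mem_image.1 hb
  choose! k hk using this
  refine Finset.card_le_card_of_injOn (fun b => f (k b))
    (fun b hb => Finset.mem_image_of_mem _ (hk b hb).1) ?_
  intro b hb b' hb' hbb
  rw [← (hk b hb).2, ← (hk b' hb').2]
  exact h _ (hk b hb).1 _ (hk b' hb').1 hbb

/-- A projective change of coordinates sends two given points to the two points at infinity on the
coordinate axes. -/
theorem exists_coordinates_of_ne {F : Type} [Field F] {q₁ q₂ : F × F} (hne : q₁ ≠ q₂) :
    ∃ (X Y : F × F → F) (σ : Set (F × F) → F × F) (U : Set (F × F)),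
      (∀ ℓ, IsLine ℓ → q₁ ∈ ℓ → ∀ q, q ∉ U → q ∈ ℓ → q₂ ∈ ℓ → False) ∧
      (∀ q, q ∈ U → q ≠ q₁ → ∀ ℓ, IsLine ℓ → q₁ ∈ ℓ → q ∈ ℓ → q₂ ∈ ℓ) ∧
      (∀ q, q ∉ U → ∀ q', q' ∉ U → X q = X q' → Y q = Y q' → q = q') ∧
      (∀ ℓ, IsLine ℓ → q₁ ∈ ℓ → ∀ q, q ∉ U → q ∈ ℓ → ∀ q', q' ∉ U → q' ∈ ℓ → X q = X q') ∧
      (∀ ℓ, IsLine ℓ → q₂ ∈ ℓ → ∀ q, q ∉ U → q ∈ ℓ → ∀ q', q' ∉ U → q' ∈ ℓ → Y q = Y q') ∧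
      (∀ ℓ, IsLine ℓ → q₁ ∉ ℓ → ∀ q, q ∉ U → q ∈ ℓ → (σ ℓ).1 * X q + (σ ℓ).2 = Y q) ∧
      ∀ ℓ, IsLine ℓ → q₁ ∉ ℓ → ∀ ℓ', IsLine ℓ' → q₁ ∉ ℓ' → σ ℓ = σ ℓ' → ℓ = ℓ' := by
  obtain ⟨x₁, y₁⟩ := q₁
  obtain ⟨x₂, y₂⟩ := q₂
  obtain ⟨e, f, δ, hδ, hδ0⟩ : ∃ e f δ : F, (x₂ - x₁) * f - (y₂ - y₁) * e = δ ∧ δ ≠ 0 := by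
    by_cases hx : x₁ = x₂
    · refine ⟨1, 0, _, rfl, ?_⟩
      have : y₁ ≠ y₂ := fun h => hne (by rw [hx, h])
      simpa [sub_eq_zero] using this
    · refine ⟨0, 1, _, rfl, ?_⟩
      simpa [sub_eq_zero] using (Ne.symm hx)
  have hcoef : ∀ ℓ : Set (F × F), ∃ c : F × F × F, IsLine ℓ →
      (c.1, c.2.1) ≠ (0, 0) ∧ ∀ q : F × F, q ∈ ℓ ↔ c.1 * q.1 + c.2.1 * q.2 - c.2.2 = 0 := by
    intro ℓ
    by_cases h : IsLine ℓ
    · obtain ⟨α, β, γ, h0, rfl⟩ := h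
      exact ⟨(α, β, γ), fun _ => ⟨h0, fun q => by simp [sub_eq_zero]⟩⟩
    · exact ⟨0, fun h' => absurd h' h⟩
  choose c hc using hcoef
  let D : F × F → F := fun q => (x₂ - x₁) * (q.2 - y₁) - (y₂ - y₁) * (q.1 - x₁)
  let y : F × F → F := fun q => (q.1 - x₁) * f - (q.2 - y₁) * e
  let lam : Set (F × F) → F × F → F := fun ℓ q => (c ℓ).1 * q.1 + (c ℓ).2.1 * q.2 - (c ℓ).2.2
  let ε : Set (F × F) → F := fun ℓ => (c ℓ).1 * e + (c ℓ).2.1 * f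
  have hmem : ∀ ℓ, IsLine ℓ → ∀ q, q ∈ ℓ ↔ lam ℓ q = 0 := fun ℓ hℓ q => (hc ℓ hℓ).2 q
  have hlam : ∀ ℓ q, δ * lam ℓ q = δ * lam ℓ (x₁, y₁)
      + y q * (lam ℓ (x₂, y₂) - lam ℓ (x₁, y₁)) + D q * ε ℓ := by
    intro ℓ q
    simp only [lam, y, D, ε, ← hδ]
    ring
  have heqn : ∀ ℓ, IsLine ℓ → ∀ q, D q ≠ 0 → q ∈ ℓ →
      lam ℓ (x₁, y₁) * ((y q - δ) / D q) = lam ℓ (x₂, y₂) * (y q / D q) + ε ℓ := by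
    intro ℓ hℓ q hq hqℓ
    have h1 := hlam ℓ q
    rw [(hmem ℓ hℓ q).1 hqℓ] at h1
    field_simp
    linear_combination h1
  have hpts : ∀ q : F × F, δ * (q.1 - x₁) = y q * (x₂ - x₁) + D q * e ∧
      δ * (q.2 - y₁) = y q * (y₂ - y₁) + D q * f := by
    intro q
    simp only [y, D, ← hδ]
    constructor <;> ring
  have hne2 : ∀ ℓ, IsLine ℓ → (x₁, y₁) ∈ ℓ → ∀ q, D q ≠ 0 → q ∈ ℓ → (x₂, y₂) ∈ ℓ → False := by
    intro ℓ hℓ h1 q hq hqℓ h2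
    rw [hmem ℓ hℓ] at h1 h2 hqℓ
    have h3 := hlam ℓ q
    rw [h1, h2, hqℓ] at h3
    have hε : ε ℓ = 0 := by
      apply mul_left_cancel₀ hq
      linear_combination -h3
    apply (hc ℓ hℓ).1
    simp only [lam] at h1 h2
    simp only [ε] at hε
    refine Prod.ext (mul_left_cancel₀ hδ0 ?_) (mul_left_cancel₀ hδ0 ?_)
    · simp only [← hδ]
      linear_combination f * (h2 - h1) - (y₂ - y₁) * hε
    · simp only [← hδ]
      linear_combination (x₂ - x₁) * hε - e * (h2 - h1)
  refine ⟨fun q => y q / D q, fun q => (y q - δ) / D q,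
    fun ℓ => (lam ℓ (x₂, y₂) / lam ℓ (x₁, y₁), ε ℓ / lam ℓ (x₁, y₁)), {q | D q = 0},
    hne2, ?_, ?_, ?_, ?_, ?_, ?_⟩
  · intro q hq hq1 ℓ hℓ h1 hqℓ
    have hq : D q = 0 := hq
    rw [hmem ℓ hℓ] at h1 hqℓ ⊢
    have h3 := hlam ℓ q
    rw [h1, hqℓ, hq] at h3
    have hy : y q ≠ 0 := by
      intro hy
      obtain ⟨h4, h5⟩ := hpts q
      rw [hy, hq] at h4 h5
      apply hq1
      refine Prod.ext (mul_left_cancel₀ hδ0 ?_) (mul_left_cancel₀ hδ0 ?_)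
      · linear_combination h4
      · linear_combination h5
    apply mul_left_cancel₀ hy
    linear_combination -h3
  · intro q hq q' hq' hX hY
    have hq : D q ≠ 0 := hq
    have hq' : D q' ≠ 0 := hq'
    have hD : D q = D q' := by
      have h1 : δ / D q = δ / D q' := by
        simp only [sub_div] at hX hY
        linear_combination hX - hY
      rw [div_eq_div_iff hq hq'] at h1
      exact (mul_left_cancel₀ hδ0 h1).symm
    have hy : y q = y q' := by
      simp only [hD] at hX
      rwa [div_left_inj' hq'] at hX
    obtain ⟨h4, h5⟩ := hpts q
    obtain ⟨h4', h5'⟩ := hpts q'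
    rw [hD, hy] at h4 h5
    refine Prod.ext (mul_left_cancel₀ hδ0 ?_) (mul_left_cancel₀ hδ0 ?_)
    · linear_combination h4 - h4'
    · linear_combination h5 - h5'
  · intro ℓ hℓ h1 q hq hqℓ q' hq' hq'ℓ
    have h2 : lam ℓ (x₂, y₂) ≠ 0 := fun h => hne2 ℓ hℓ h1 q hq hqℓ ((hmem ℓ hℓ _).2 h)
    have e1 := heqn ℓ hℓ q hq hqℓ
    have e2 := heqn ℓ hℓ q' hq' hq'ℓ
    rw [(hmem ℓ hℓ _).1 h1] at e1 e2
    apply mul_left_cancel₀ h2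
    linear_combination e2 - e1
  · intro ℓ hℓ h2 q hq hqℓ q' hq' hq'ℓ
    have h1 : lam ℓ (x₁, y₁) ≠ 0 := fun h => hne2 ℓ hℓ ((hmem ℓ hℓ _).2 h) q hq hqℓ h2
    have e1 := heqn ℓ hℓ q hq hqℓ
    have e2 := heqn ℓ hℓ q' hq' hq'ℓ
    rw [(hmem ℓ hℓ _).1 h2] at e1 e2
    apply mul_left_cancel₀ h1
    linear_combination e1 - e2
  · intro ℓ hℓ h1 q hq hqℓ
    have h1 : lam ℓ (x₁, y₁) ≠ 0 := fun h => h1 ((hmem ℓ hℓ _).2 h)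
    have e1 := heqn ℓ hℓ q hq hqℓ
    apply mul_left_cancel₀ h1
    rw [e1]
    field_simp
  · intro ℓ hℓ h1 ℓ' hℓ' h1' h
    have h1 : lam ℓ (x₁, y₁) ≠ 0 := fun h => h1 ((hmem ℓ hℓ _).2 h)
    have h1' : lam ℓ' (x₁, y₁) ≠ 0 := fun h => h1' ((hmem ℓ' hℓ' _).2 h)
    obtain ⟨hs, ht⟩ := Prod.ext_iff.1 h
    simp only at hs ht
    rw [div_eq_div_iff h1 h1'] at hs ht
    have hprop : ∀ q, lam ℓ' (x₁, y₁) * lam ℓ q = lam ℓ (x₁, y₁) * lam ℓ' q := by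
      intro q
      apply mul_left_cancel₀ hδ0
      linear_combination lam ℓ' (x₁, y₁) * hlam ℓ q - lam ℓ (x₁, y₁) * hlam ℓ' q + y q * hs
        + D q * ht
    ext q
    rw [hmem ℓ hℓ, hmem ℓ' hℓ']
    constructor <;> intro h
    · have := hprop q
      rw [h, mul_zero] at this
      exact (mul_eq_zero.1 this.symm).resolve_left h1
    · have := hprop q
      rw [h, mul_zero] at this
      exact (mul_eq_zero.1 this).resolve_left h1'

/-- Incidences at the intersection points of few lines through one point with few lines through
another point. -/
theorem card_incidences_two_pencils_sq_le {F : Type} [Field F] {q₁ q₂ : F × F} (hne : q₁ ≠ q₂)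
    (P : Finset (F × F)) (L : Finset (Set (F × F))) (hL : ∀ ℓ ∈ L, IsLine ℓ)
    (T : F × F → Finset (Set (F × F))) (hT : ∀ q ∈ P, T q ⊆ L) (hmem : ∀ q ∈ P, ∀ ℓ ∈ T q, q ∈ ℓ)
    (f g : F × F → Set (F × F)) (hf : ∀ q ∈ P, IsLine (f q) ∧ q₁ ∈ f q ∧ q ∈ f q)
    (hg : ∀ q ∈ P, IsLine (g q) ∧ q₂ ∈ g q ∧ q ∈ g q) (hfg : ∀ q ∈ P, f q ≠ g q)
    (hq₁ : q₁ ∉ P) (hq₂ : q₂ ∉ P) {ρ k : ℕ} (hfρ : (P.image f).card ≤ ρ)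
    (hgρ : (P.image g).card ≤ ρ) (hk : ∀ q ∈ P, (T q).card ≤ k)
    (hF : ∀ j : ℕ, 0 < j → (j : ℝ) ≤ 20 * √(2 * (ρ * L.card) : ℕ) → (j : F) ≠ 0) :
    ((∑ q ∈ P, ((T q).filter fun ℓ => q₁ ∉ ℓ).card : ℕ) : ℝ) ^ 2
      ≤ ρ * (40 * ((2 * (ρ * L.card) : ℕ) * √(2 * (ρ * L.card) : ℕ))
        + (max ρ k : ℕ) * (2 * (ρ * L.card) : ℕ)) := by
  obtain ⟨X, Y, σ, U, -, hU, hXY, hX, hY, hσ, hσi⟩ := exists_coordinates_of_ne hne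
  have hPU : ∀ q ∈ P, q ∉ U := by
    intro q hq hqU
    have h1 : q ≠ q₁ := fun h => hq₁ (h ▸ hq)
    have h2 : q ≠ q₂ := fun h => hq₂ (h ▸ hq)
    have h3 := hU q hqU h1 (f q) (hf q hq).1 (hf q hq).2.1 (hf q hq).2.2
    exact hfg q hq ((hf q hq).1.eq_of_mem_of_mem (hg q hq).1 h2 (hf q hq).2.2 h3
      (hg q hq).2.2 (hg q hq).2.1)
  have hA : (P.image X).card ≤ ρ := by
    refine (P.card_image_le_card_image f X fun q hq q' hq' h => ?_).trans hfρ
    exact hX (f q) (hf q hq).1 (hf q hq).2.1 q (hPU q hq) (hf q hq).2.2 q' (hPU q' hq')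
      (h ▸ (hf q' hq').2.2)
  have hB : (P.image Y).card ≤ ρ := by
    refine (P.card_image_le_card_image g Y fun q hq q' hq' h => ?_).trans hgρ
    exact hY (g q) (hg q hq).1 (hg q hq).2.1 q (hPU q hq) (hg q hq).2.2 q' (hPU q' hq')
      (h ▸ (hg q' hq').2.2)
  obtain ⟨J, hJ⟩ : ∃ J : F → F × F → Prop, ∀ a l,
      J a l ↔ ∃ q ∈ P, ∃ ℓ ∈ T q, q₁ ∉ ℓ ∧ X q = a ∧ σ ℓ = l := ⟨_, fun _ _ => Iff.rfl⟩
  have hLc : (L.image σ).card ≤ L.card := Finset.card_image_le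
  have hN : 2 * ((P.image X).card * (L.image σ).card) ≤ 2 * (ρ * L.card) :=
    Nat.mul_le_mul_left _ (Nat.mul_le_mul hA hLc)
  have hNr : ((2 * ((P.image X).card * (L.image σ).card) : ℕ) : ℝ) ≤ (2 * (ρ * L.card) : ℕ) :=
    Nat.cast_le.2 hN
  have hsqrt := Real.sqrt_le_sqrt hNr
  have hkJ : ∀ a ∈ P.image X, ∀ y,
      ((L.image σ).filter fun l => J a l ∧ l.1 * a + l.2 = y).card ≤ k := by
    intro a ha y
    by_cases hq : ∃ q ∈ P, X q = a ∧ Y q = y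
    · obtain ⟨q, hq, hqX, hqY⟩ := hq
      refine le_trans (Finset.card_le_card (t := (T q).image σ) fun l hl => ?_)
        (Finset.card_image_le.trans (hk q hq))
      obtain ⟨-, h3, h4⟩ := Finset.mem_filter.1 hl
      obtain ⟨q', hq', ℓ, hℓ, h1, h2, h3⟩ := (hJ _ _).1 h3
      have h5 := hσ ℓ (hL ℓ (hT q' hq' hℓ)) h1 q' (hPU q' hq') (hmem q' hq' ℓ hℓ)
      rw [h2, h3, h4] at h5
      have h6 := hXY q (hPU q hq) q' (hPU q' hq') (hqX.trans h2.symm) (hqY.trans h5)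
      rw [h6]
      exact Finset.mem_image.2 ⟨ℓ, hℓ, h3⟩
    · rw [Finset.card_eq_zero.2]
      · exact Nat.zero_le _
      refine Finset.filter_eq_empty_iff.2 ?_
      rintro l - ⟨h3, h4⟩
      obtain ⟨q', hq', ℓ, hℓ, h1, h2, h3⟩ := (hJ _ _).1 h3
      have h5 := hσ ℓ (hL ℓ (hT q' hq' hℓ)) h1 q' (hPU q' hq') (hmem q' hq' ℓ hℓ)
      rw [h2, h3, h4] at h5
      exact hq ⟨q', hq', h2, h5.symm⟩
  have main := card_incidences_cartesian_sq_le (P.image X) (P.image Y) (L.image σ) J rfl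
    (fun j h1 h2 => hF j h1 (h2.trans (mul_le_mul_of_nonneg_left hsqrt (by norm_num))))
    (by
      intro a _ l _ h3
      obtain ⟨q', hq', ℓ, hℓ, h1, h2, h3⟩ := (hJ _ _).1 h3
      have h5 := hσ ℓ (hL ℓ (hT q' hq' hℓ)) h1 q' (hPU q' hq') (hmem q' hq' ℓ hℓ)
      rw [h2, h3] at h5
      rw [h5]
      exact Finset.mem_image_of_mem _ hq') hkJ
  have hcount : ∑ q ∈ P, ((T q).filter fun ℓ => q₁ ∉ ℓ).card ≤
      (((P.image X) ×ˢ (L.image σ)).filter fun x => J x.1 x.2).card := by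
    rw [← Finset.card_sigma]
    refine Finset.card_le_card_of_injOn (fun x => (X x.1, σ x.2)) ?_ ?_
    · rintro ⟨q, ℓ⟩ hx
      obtain ⟨hq, hℓ⟩ := Finset.mem_sigma.1 hx
      obtain ⟨hℓ, h1⟩ := Finset.mem_filter.1 hℓ
      refine Finset.mem_coe.2 (Finset.mem_filter.2 ⟨Finset.mem_product.2
        ⟨Finset.mem_image_of_mem _ hq, Finset.mem_image_of_mem _ (hT q hq hℓ)⟩, ?_⟩)
      exact (hJ _ _).2 ⟨q, hq, ℓ, hℓ, h1, rfl, rfl⟩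
    · rintro ⟨q, ℓ⟩ hx ⟨q', ℓ'⟩ hx' h
      obtain ⟨hq, hℓ⟩ := Finset.mem_sigma.1 hx
      obtain ⟨hℓ, h1⟩ := Finset.mem_filter.1 hℓ
      obtain ⟨hq', hℓ'⟩ := Finset.mem_sigma.1 hx'
      obtain ⟨hℓ', h1'⟩ := Finset.mem_filter.1 hℓ'
      simp only [Prod.mk.injEq] at h hq hq' hℓ hℓ' h1 h1'
      have e1 := hσ ℓ (hL ℓ (hT q hq hℓ)) h1 q (hPU q hq) (hmem q hq ℓ hℓ)
      have e2 := hσ ℓ' (hL ℓ' (hT q' hq' hℓ')) h1' q' (hPU q' hq') (hmem q' hq' ℓ' hℓ')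
      have e3 := hσi ℓ (hL ℓ (hT q hq hℓ)) h1 ℓ' (hL ℓ' (hT q' hq' hℓ')) h1' h.2
      rw [h.1, h.2] at e1
      have e4 := hXY q (hPU q hq) q' (hPU q' hq') h.1 (e1.symm.trans e2)
      rw [e3, e4]
  have hcount' : ((∑ q ∈ P, ((T q).filter fun ℓ => q₁ ∉ ℓ).card : ℕ) : ℝ) ≤
      (((P.image X) ×ˢ (L.image σ)).filter fun x => J x.1 x.2).card := Nat.cast_le.2 hcount
  refine (pow_le_pow_left₀ (Nat.cast_nonneg _) hcount' 2).trans (main.trans ?_)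
  have hmax : max (P.image X).card k ≤ max ρ k := max_le_max_right k hA
  refine mul_le_mul (Nat.cast_le.2 hB) (add_le_add (mul_le_mul_of_nonneg_left
    (mul_le_mul hNr hsqrt (Real.sqrt_nonneg _) (Nat.cast_nonneg _)) (by norm_num))
    (mul_le_mul (Nat.cast_le.2 hmax) hNr (Nat.cast_nonneg _) (Nat.cast_nonneg _)))
    (add_nonneg (mul_nonneg (by norm_num) (mul_nonneg (Nat.cast_nonneg _) (Real.sqrt_nonneg _)))
      (mul_nonneg (Nat.cast_nonneg _) (Nat.cast_nonneg _))) (Nat.cast_nonneg _)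

theorem Finset.exists_subset_card_le_mul_sum_le {β : Type*} (y : β → ℝ) {ρ : ℕ} (r : ℕ)
    (hρ : ρ ≤ r) (s : Finset β) (hy : ∀ l ∈ s, 0 ≤ y l) (hs : s.card ≤ r) :
    ∃ A ⊆ s, A.card ≤ ρ ∧ ρ * ∑ l ∈ s, y l ≤ r * ∑ l ∈ A, y l := by
  induction r, hρ using Nat.le_induction generalizing s with
  | base => exact ⟨s, Finset.Subset.refl _, hs, le_rfl⟩
  | succ r hr ih =>
    have hr' : (ρ : ℝ) ≤ r := by exact_mod_cast hr
    rcases hs.lt_or_eq with hlt | heq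
    · obtain ⟨A, hA, hAc, h⟩ := ih s hy (Nat.lt_succ_iff.1 hlt)
      refine ⟨A, hA, hAc, h.trans (mul_le_mul_of_nonneg_right (by push_cast; linarith)
        (Finset.sum_nonneg fun l hl => hy l (hA hl)))⟩
    · have hne : s.Nonempty := by rw [← Finset.card_pos]; omega
      obtain ⟨l, hl, hmin⟩ := s.exists_min_image y hne
      have hc : (s.erase l).card = r := by rw [Finset.card_erase_of_mem hl]; omega
      obtain ⟨A, hA, hAc, h⟩ := ih (s.erase l) (fun l' h' => hy l' (Finset.mem_of_mem_erase h'))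
        hc.le
      refine ⟨A, hA.trans (Finset.erase_subset _ _), hAc, ?_⟩
      have h0 : 0 ≤ ∑ l ∈ A, y l :=
        Finset.sum_nonneg fun l' h' => hy l' (Finset.mem_of_mem_erase (hA h'))
      have h1 : (r : ℝ) * y l ≤ ∑ l' ∈ s.erase l, y l' := by
        rw [← hc, ← nsmul_eq_mul]
        exact Finset.card_nsmul_le_sum _ _ _ fun l' h' => hmin l' (Finset.mem_of_mem_erase h')
      rw [← Finset.add_sum_erase s y hl]
      push_cast
      rcases Nat.eq_zero_or_pos r with hr0 | hr0
      · have : (ρ : ℝ) = 0 := by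
          have : ρ = 0 := by omega
          rw [this, Nat.cast_zero]
        rw [this, zero_mul]
        positivity
      · have hr0' : (0 : ℝ) < r := by exact_mod_cast hr0
        have hρ0 : (0 : ℝ) ≤ ρ := Nat.cast_nonneg _
        apply le_of_mul_le_mul_left _ hr0'
        have h2 := mul_le_mul_of_nonneg_left h1 hρ0
        have h3 := mul_le_mul_of_nonneg_left h hr0'.le
        nlinarith

theorem pencil_count_arith {μ n ρ r W G N : ℝ} (hμ : 0 < μ) (hρ : 0 ≤ ρ) (hr : 0 ≤ r)
    (hW : 3 * (ρ * μ ^ 2 * r) ≤ 8 * n * W) (hG : W ^ 2 ≤ 2 * (μ * G)) (hN : G ≤ μ ^ 2 * N) :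
    9 * (ρ ^ 2 * μ * r ^ 2) ≤ 128 * (n ^ 2 * N) := by
  apply le_of_mul_le_mul_left _ (pow_pos hμ 3)
  calc μ ^ 3 * (9 * (ρ ^ 2 * μ * r ^ 2)) = (3 * (ρ * μ ^ 2 * r)) ^ 2 := by ring
    _ ≤ (8 * n * W) ^ 2 := pow_le_pow_left₀ (by positivity) hW 2
    _ = 64 * n ^ 2 * W ^ 2 := by ring
    _ ≤ 64 * n ^ 2 * (2 * (μ * (μ ^ 2 * N))) := by gcongr; exact hG.trans (by gcongr)
    _ = μ ^ 3 * (128 * (n ^ 2 * N)) := by ring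

set_option maxHeartbeats 1000000 in
/-- In a dense linear space, some two points have few lines through them whose pairwise
intersections contain many points. -/
theorem exists_two_pencils {α β : Type*} (Q : Finset α) (L : Finset β) (T : α → Finset β)
    (hT : ∀ q ∈ Q, T q ⊆ L) {r ρ : ℕ} (hr : ∀ q ∈ Q, (T q).card = r)
    (hlin : ∀ q ∈ Q, ∀ q' ∈ Q, q ≠ q' → ∀ l ∈ T q, l ∈ T q' → ∀ l' ∈ T q, l' ∈ T q' → l = l')
    (hρ0 : 0 < ρ) (hρr : ρ ≤ r) (hQ : Q.Nonempty) (hn : 32 * L.card ≤ ρ * r ^ 2)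
    (hI : 4 * L.card ≤ Q.card * r) :
    ∃ q₁ ∈ Q, ∃ q₂ ∈ Q, q₁ ≠ q₂ ∧ ∃ P ⊆ Q, q₁ ∉ P ∧ q₂ ∉ P ∧ ∃ f g : α → β,
      (∀ q ∈ P, f q ∈ T q₁ ∧ f q ∈ T q ∧ g q ∈ T q₂ ∧ g q ∈ T q ∧ f q ≠ g q) ∧
      (P.image f).card ≤ ρ ∧ (P.image g).card ≤ ρ ∧
      9 * (ρ ^ 2 * Q.card * r ^ 2 : ℝ) ≤ 128 * (L.card ^ 2 * P.card) := by
  set μ := Q.card with hμ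
  set n := L.card with hn'
  have hμ0 : (0 : ℝ) < μ := by exact_mod_cast Finset.card_pos.2 hQ
  have hr0 : (0 : ℝ) < r := by exact_mod_cast hρ0.trans_le hρr
  have hρ0' : (0 : ℝ) < ρ := by exact_mod_cast hρ0
  have hn0 : (0 : ℝ) < n := by
    obtain ⟨q, hq⟩ := hQ
    have h1 := Finset.card_le_card (hT q hq)
    rw [hr q hq] at h1
    exact_mod_cast (hρ0.trans_le hρr).trans_le h1
  have hnR : 32 * (n : ℝ) ≤ ρ * r ^ 2 := by exact_mod_cast hn
  have hIR : 4 * (n : ℝ) ≤ μ * r := by exact_mod_cast hI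
  let pts : β → Finset α := fun l => Q.filter fun q => l ∈ T q
  let x : β → ℝ := fun l => (pts l).card
  have hx_sum : ∑ l ∈ L, x l = μ * r := by
    have h := Finset.sum_card_bipartiteAbove_eq_sum_card_bipartiteBelow (s := Q) (t := L)
      (fun q l => l ∈ T q)
    have h1 : ∀ q ∈ Q, (Finset.bipartiteAbove (fun q l => l ∈ T q) L q).card = r := by
      intro q hq
      rw [← hr q hq]
      congr 1
      ext l
      simp only [Finset.bipartiteAbove, Finset.mem_filter]
      exact ⟨fun h => h.2, fun h => ⟨hT q hq h, h⟩⟩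
    rw [Finset.sum_congr rfl h1, Finset.sum_const, smul_eq_mul] at h
    have h2 : ((∑ l ∈ L, (pts l).card : ℕ) : ℝ) = (μ * r : ℕ) := by rw [← hμ] at h; rw [h]; rfl
    push_cast at h2
    exact h2
  have hx_sq : ∑ l ∈ L, x l ^ 2 ≤ μ ^ 2 + μ * r := by
    have h := Finset.sum_card_bipartiteAbove_eq_sum_card_bipartiteBelow (s := Q ×ˢ Q) (t := L)
      (fun q l => l ∈ T q.1 ∧ l ∈ T q.2)
    have h1 : ∀ q ∈ Q ×ˢ Q, (Finset.bipartiteAbove (fun q l => l ∈ T q.1 ∧ l ∈ T q.2) L q).card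
        ≤ 1 + if q.1 = q.2 then r else 0 := by
      rintro ⟨q, q'⟩ hq
      obtain ⟨hq, hq'⟩ := Finset.mem_product.1 hq
      simp only at hq hq' ⊢
      split_ifs with hqq
      · refine le_trans (Finset.card_le_card (t := T q) fun l hl => ?_)
          ((hr q hq).le.trans (by omega))
        exact (Finset.mem_filter.1 hl).2.1
      · refine Finset.card_le_one.2 fun l hl l' hl' => ?_
        obtain ⟨-, h1, h2⟩ := Finset.mem_filter.1 hl
        obtain ⟨-, h3, h4⟩ := Finset.mem_filter.1 hl'
        exact hlin q hq q' hq' hqq l h1 h2 l' h3 h4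
    have h2 := Finset.sum_le_sum h1
    rw [h, Finset.sum_add_distrib, Finset.sum_const, Finset.card_product, smul_eq_mul, mul_one,
      Finset.sum_product] at h2
    have h3 : ∑ q ∈ Q, ∑ q' ∈ Q, (if q = q' then r else 0) = μ * r := by
      rw [Finset.sum_congr rfl (fun q hq => by rw [Finset.sum_ite_eq, if_pos hq]),
        Finset.sum_const, smul_eq_mul]
    rw [h3] at h2
    have h4 : ∀ l ∈ L, x l ^ 2 =
        ((Finset.bipartiteBelow (fun q l => l ∈ T q.1 ∧ l ∈ T q.2) (Q ×ˢ Q) l).card : ℝ) := by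
      intro l hl
      simp only [x, pts]
      rw [pow_two, ← Nat.cast_mul, ← Finset.card_product, ← Finset.filter_product]
      rfl
    rw [Finset.sum_congr rfl h4, ← Nat.cast_sum]
    have h5 := (Nat.cast_le (α := ℝ)).2 h2
    rw [pow_two]
    push_cast at h5 ⊢
    exact h5
  set lam : ℝ := ρ * μ * r / (8 * n) with hlam
  have hlam0 : 0 < lam := by positivity
  set L₁ := L.filter fun l => x l ≤ lam + 1 with hL₁
  have hxx : ∀ l, 0 ≤ x l * (x l - 1) := by
    intro l
    simp only [x]
    rcases Nat.eq_zero_or_pos (pts l).card with h | h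
    · simp [h]
    · have : (1 : ℝ) ≤ (pts l).card := by exact_mod_cast h
      exact mul_nonneg (by linarith) (by linarith)
  have hlight : 3 / 4 * (μ * r) ≤ ∑ l ∈ L₁, x l := by
    have h1 : lam * ∑ l ∈ L.filter (fun l => ¬ x l ≤ lam + 1), x l ≤ μ ^ 2 := by
      calc lam * ∑ l ∈ L.filter (fun l => ¬ x l ≤ lam + 1), x l
          ≤ ∑ l ∈ L.filter (fun l => ¬ x l ≤ lam + 1), x l * (x l - 1) := by
            rw [Finset.mul_sum]
            refine Finset.sum_le_sum fun l hl => ?_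
            have := (Finset.mem_filter.1 hl).2
            push Not at this
            have h0 : 0 ≤ x l := Nat.cast_nonneg _
            nlinarith
        _ ≤ ∑ l ∈ L, x l * (x l - 1) :=
            Finset.sum_le_sum_of_subset_of_nonneg (Finset.filter_subset _ _) fun l _ _ => hxx l
        _ = ∑ l ∈ L, x l ^ 2 - ∑ l ∈ L, x l := by
            rw [← Finset.sum_sub_distrib]
            exact Finset.sum_congr rfl fun l _ => by ring
        _ ≤ μ ^ 2 := by rw [hx_sum]; linarith
    have h2 : (μ : ℝ) ^ 2 ≤ lam * (1 / 4 * (μ * r)) := by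
      rw [hlam, div_mul_eq_mul_div, le_div_iff₀ (by positivity)]
      have := mul_le_mul_of_nonneg_left hnR (sq_nonneg (μ : ℝ))
      nlinarith
    have h3 := le_of_mul_le_mul_left (h1.trans h2) hlam0
    have h4 := Finset.sum_filter_add_sum_filter_not L (fun l => x l ≤ lam + 1) x
    rw [hx_sum] at h4
    linarith
  have hpairs : 3 * (μ ^ 2 * r ^ 2 : ℝ) ≤ 8 * n * ∑ l ∈ L₁, x l * (x l - 1) := by
    have h1 : (∑ l ∈ L₁, x l) ^ 2 ≤ n * ∑ l ∈ L₁, x l ^ 2 :=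
      (sq_sum_le_card_mul_sum_sq).trans (mul_le_mul_of_nonneg_right
        (Nat.cast_le.2 (Finset.card_le_card (Finset.filter_subset _ _)))
        (Finset.sum_nonneg fun _ _ => sq_nonneg _))
    have h2 : ∑ l ∈ L₁, x l * (x l - 1) = ∑ l ∈ L₁, x l ^ 2 - ∑ l ∈ L₁, x l := by
      rw [← Finset.sum_sub_distrib]
      exact Finset.sum_congr rfl fun l _ => by ring
    rw [h2]
    have h3 : 3 * (n : ℝ) ≤ ∑ l ∈ L₁, x l := by linarith
    have h4 : (3 / 4 * (μ * r) : ℝ) ^ 2 ≤ (∑ l ∈ L₁, x l) ^ 2 :=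
      pow_le_pow_left₀ (by positivity) hlight 2
    nlinarith
  have hA : ∀ q, ∃ A : Finset β, q ∈ Q → A ⊆ (T q).filter (fun l => l ∈ L₁) ∧ A.card ≤ ρ ∧
      ρ * ∑ l ∈ (T q).filter (fun l => l ∈ L₁), (x l - 1) ≤ r * ∑ l ∈ A, (x l - 1) := by
    intro q
    by_cases hq : q ∈ Q
    · obtain ⟨A, h⟩ := Finset.exists_subset_card_le_mul_sum_le (fun l => x l - 1) r hρr
        ((T q).filter fun l => l ∈ L₁) (by
          intro l hl
          have : 0 < (pts l).card :=
            Finset.card_pos.2 ⟨q, Finset.mem_filter.2 ⟨hq, (Finset.mem_filter.1 hl).1⟩⟩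
          have : (1 : ℝ) ≤ x l := by simp only [x]; exact_mod_cast this
          linarith) ((Finset.card_le_card (Finset.filter_subset _ _)).trans (hr q hq).le)
      exact ⟨A, fun _ => h⟩
    · exact ⟨∅, fun h => absurd h hq⟩
  choose A hA using hA
  have hAT : ∀ q ∈ Q, ∀ l ∈ A q, l ∈ T q := fun q hq l hl =>
    (Finset.mem_filter.1 ((hA q hq).1 hl)).1
  have hAL : ∀ q ∈ Q, ∀ l ∈ A q, x l ≤ lam + 1 := fun q hq l hl =>
    (Finset.mem_filter.1 (Finset.mem_filter.1 ((hA q hq).1 hl)).2).2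
  let W : Finset (Σ _ : α, Σ _ : β, α) :=
    Q.sigma fun q₁ => (A q₁).sigma fun l => (pts l).erase q₁
  have hWcard : (W.card : ℝ) = ∑ q ∈ Q, ∑ l ∈ A q, (x l - 1) := by
    simp only [W, Finset.card_sigma, Nat.cast_sum]
    refine Finset.sum_congr rfl fun q hq => Finset.sum_congr rfl fun l hl => ?_
    have hm : q ∈ pts l := Finset.mem_filter.2 ⟨hq, hAT q hq l hl⟩
    rw [Finset.card_erase_of_mem hm, Nat.cast_sub (Finset.card_pos.2 ⟨q, hm⟩), Nat.cast_one]
  have hWmem : ∀ w ∈ W, w.1 ∈ Q ∧ w.2.1 ∈ A w.1 ∧ w.2.2 ∈ Q ∧ w.2.1 ∈ T w.2.2 ∧ w.2.2 ≠ w.1 := by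
    rintro ⟨q₁, l, q⟩ hw
    obtain ⟨h1, h2⟩ := Finset.mem_sigma.1 hw
    obtain ⟨h2, h3⟩ := Finset.mem_sigma.1 h2
    obtain ⟨h3, h4⟩ := Finset.mem_erase.1 h3
    obtain ⟨h4, h5⟩ := Finset.mem_filter.1 h4
    exact ⟨h1, h2, h4, h5, h3⟩
  have hW : 3 * (ρ * μ ^ 2 * r : ℝ) ≤ 8 * n * W.card := by
    have h1 : ∑ q ∈ Q, ∑ l ∈ (T q).filter (fun l => l ∈ L₁), (x l - 1)
        = ∑ l ∈ L₁, x l * (x l - 1) := by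
      rw [Finset.sum_comm' (t' := L₁) (s' := pts)]
      · refine Finset.sum_congr rfl fun l _ => ?_
        rw [Finset.sum_const, nsmul_eq_mul]
      · intro q l
        simp only [pts, Finset.mem_filter]
        tauto
    have h2 : (ρ : ℝ) * ∑ l ∈ L₁, x l * (x l - 1) ≤ r * W.card := by
      rw [← h1, hWcard, Finset.mul_sum, Finset.mul_sum]
      exact Finset.sum_le_sum fun q hq => (hA q hq).2.2
    have h3 := mul_le_mul_of_nonneg_left hpairs hρ0'.le
    apply le_of_mul_le_mul_left _ hr0
    nlinarith
  have hCS := card_sq_le_card_mul_card_filter_eq W Q (fun w => w.2.2)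
    fun w hw => (hWmem w hw).2.2.1
  set same := (W ×ˢ W).filter fun w => w.1.2.2 = w.2.2.2 with hsame
  have hbad : ((same.filter fun w => w.1.2.1 = w.2.2.1).card : ℝ) ≤ lam * W.card := by
    have h1 : (same.filter fun w => w.1.2.1 = w.2.2.1).card ≤
        (W.sigma fun w => (pts w.2.1).erase w.2.2).card := by
      refine Finset.card_le_card_of_injOn (fun w => ⟨w.1, w.2.1⟩) ?_ ?_
      · rintro ⟨⟨q₁, l, q⟩, ⟨q₂, l', q'⟩⟩ hw
        obtain ⟨hw, hl⟩ := Finset.mem_filter.1 hw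
        obtain ⟨hw, hq⟩ := Finset.mem_filter.1 hw
        obtain ⟨hw, hw'⟩ := Finset.mem_product.1 hw
        simp only at hl hq
        subst hl hq
        obtain ⟨h1, h2, h3, h4, h5⟩ := hWmem _ hw'
        exact Finset.mem_coe.2 (Finset.mem_sigma.2 ⟨hw, Finset.mem_erase.2
          ⟨h5.symm, Finset.mem_filter.2 ⟨h1, hAT _ h1 _ h2⟩⟩⟩)
      · rintro ⟨⟨q₁, l, q⟩, ⟨q₂, l', q'⟩⟩ hw ⟨⟨q₁', m, p⟩, ⟨q₂', m', p'⟩⟩ hw' h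
        have e1 := (Finset.mem_filter.1 hw).2
        have e2 := (Finset.mem_filter.1 (Finset.mem_filter.1 hw).1).2
        have e3 := (Finset.mem_filter.1 hw').2
        have e4 := (Finset.mem_filter.1 (Finset.mem_filter.1 hw').1).2
        simp only at e1 e2 e3 e4
        subst e1 e2 e3 e4
        simp only [Sigma.mk.injEq, heq_eq_eq] at h
        obtain ⟨⟨rfl, rfl, rfl⟩, rfl⟩ := h
        rfl
    have h2 := (Nat.cast_le (α := ℝ)).2 h1
    rw [Finset.card_sigma, Nat.cast_sum] at h2
    refine h2.trans ?_
    rw [mul_comm, ← nsmul_eq_mul]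
    refine Finset.sum_le_card_nsmul _ _ _ fun w hw => ?_
    obtain ⟨h1, h2, h3, h4, h5⟩ := hWmem _ hw
    have hm : w.2.2 ∈ pts w.2.1 := Finset.mem_filter.2 ⟨h3, h4⟩
    rw [Finset.card_erase_of_mem hm, Nat.cast_sub (Finset.card_pos.2 ⟨_, hm⟩), Nat.cast_one]
    have := hAL _ h1 _ h2
    simp only [x] at this
    linarith
  set good := same.filter fun w => ¬ w.1.2.1 = w.2.2.1 with hgood
  have hgood_card : (W.card : ℝ) ^ 2 ≤ 2 * (μ * good.card) := by
    have h1 : same.card = (same.filter fun w => w.1.2.1 = w.2.2.1).card + good.card :=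
      (Finset.card_filter_add_card_filter_not _).symm
    have h2 := (Nat.cast_le (α := ℝ)).2 hCS
    have h1' := congrArg (Nat.cast : ℕ → ℝ) h1
    push_cast at h2 h1'
    have h3 : μ * lam ≤ W.card / 2 := by
      rw [hlam, mul_div_assoc', div_le_iff₀ (by positivity)]
      nlinarith
    have h4 := mul_le_mul_of_nonneg_right h3 (Nat.cast_nonneg (α := ℝ) W.card)
    rw [h1'] at h2
    have h5 := mul_le_mul_of_nonneg_left hbad hμ0.le
    rw [← hμ] at h2
    nlinarith
  obtain ⟨⟨q₁, q₂⟩, hqq, hfib⟩ := Finset.exists_le_card_fiber_of_nsmul_le_card_of_maps_to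
    (s := good) (t := Q ×ˢ Q) (f := fun w => (w.1.1, w.2.1)) (b := ((good.card : ℝ) / μ ^ 2))
    (by
      intro w hw
      have := Finset.mem_product.1 (Finset.mem_filter.1 (Finset.mem_filter.1 hw).1).1
      exact Finset.mem_product.2 ⟨(hWmem _ this.1).1, (hWmem _ this.2).1⟩)
    (hQ.product hQ) (by
      rw [Finset.card_product, nsmul_eq_mul]
      push_cast
      rw [← hμ]
      apply le_of_eq
      field_simp)
  obtain ⟨hq₁, hq₂⟩ := Finset.mem_product.1 hqq
  simp only at hq₁ hq₂
  set fib := good.filter fun w => (w.1.1, w.2.1) = (q₁, q₂) with hfibdef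
  have hWpos : (0 : ℝ) < W.card := by
    have : (0 : ℝ) < 8 * n * W.card := lt_of_lt_of_le (by positivity) hW
    exact (pos_iff_pos_of_mul_pos this).1 (by positivity)
  have hfibmem : ∀ w ∈ fib, ∃ l l' q, w = (⟨q₁, l, q⟩, ⟨q₂, l', q⟩) ∧ l ∈ A q₁ ∧ l' ∈ A q₂ ∧
      q ∈ Q ∧ l ∈ T q ∧ l' ∈ T q ∧ q ≠ q₁ ∧ q ≠ q₂ ∧ l ≠ l' := by
    rintro ⟨⟨a, l, q⟩, ⟨b, l', q'⟩⟩ hwf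
    obtain ⟨hwg, h0⟩ := Finset.mem_filter.1 hwf
    obtain ⟨hws, h1⟩ := Finset.mem_filter.1 hwg
    obtain ⟨hww, h2⟩ := Finset.mem_filter.1 hws
    obtain ⟨hw, hw'⟩ := Finset.mem_product.1 hww
    simp only [Prod.mk.injEq] at h0 h1 h2
    obtain ⟨rfl, rfl⟩ := h0
    subst h2
    obtain ⟨-, a1, a2, a3, a4⟩ := hWmem _ hw
    obtain ⟨-, b1, b2, b3, b4⟩ := hWmem _ hw'
    exact ⟨l, l', q, rfl, a1, b1, a2, a3, b3, a4, b4, h1⟩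
  have hgoodpos : (0 : ℝ) < good.card := by
    have : (0 : ℝ) < 2 * (μ * good.card) := lt_of_lt_of_le (by positivity) hgood_card
    by_contra h
    have h0 : (good.card : ℝ) = 0 := le_antisymm (not_lt.1 h) (Nat.cast_nonneg _)
    rw [h0] at this
    simp at this
  have hfibpos : 0 < fib.card := by
    have : (0 : ℝ) < fib.card := lt_of_lt_of_le (by positivity) hfib
    exact_mod_cast this
  have hq₁₂ : q₁ ≠ q₂ := by
    rintro rfl
    obtain ⟨w, hw⟩ := Finset.card_pos.1 hfibpos
    obtain ⟨l, l', q, -, hl, hl', hq, hlq, hlq', hne, -, hll⟩ := hfibmem w hw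
    exact hll (hlin q hq q₁ hq₁ hne l hlq (hAT _ hq₁ _ hl) l' hlq' (hAT _ hq₁ _ hl'))
  have hP : ∀ q, ∃ l l', q ∈ fib.image (fun w => w.1.2.2) → l ∈ A q₁ ∧ l' ∈ A q₂ ∧
      q ∈ Q ∧ l ∈ T q ∧ l' ∈ T q ∧ q ≠ q₁ ∧ q ≠ q₂ ∧ l ≠ l' := by
    intro q
    by_cases hq : q ∈ fib.image fun w => w.1.2.2
    · obtain ⟨w, hw, rfl⟩ := Finset.mem_image.1 hq
      obtain ⟨l, l', q, rfl, h⟩ := hfibmem w hw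
      exact ⟨l, l', fun _ => h⟩
    · obtain ⟨w, hw⟩ := Finset.card_pos.1 hfibpos
      exact ⟨w.1.2.1, w.1.2.1, fun h => absurd h hq⟩
  choose f g hfg using hP
  have hinj : fib.card ≤ (fib.image fun w => w.1.2.2).card := by
    rw [Finset.card_image_of_injOn]
    intro w hw w' hw' h
    obtain ⟨l, l', q, rfl, a1, a2, a3, a4, a5, a6, a7, a8⟩ := hfibmem w hw
    obtain ⟨k, k', q', rfl, b1, b2, b3, b4, b5, b6, b7, b8⟩ := hfibmem w' hw'
    simp only at h
    subst h
    have e1 := hlin q a3 q₁ hq₁ a6 l a4 (hAT _ hq₁ _ a1) k b4 (hAT _ hq₁ _ b1)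
    have e2 := hlin q a3 q₂ hq₂ a7 l' a5 (hAT _ hq₂ _ a2) k' b5 (hAT _ hq₂ _ b2)
    rw [e1, e2]
  refine ⟨q₁, hq₁, q₂, hq₂, hq₁₂, fib.image fun w => w.1.2.2, fun q hq => (hfg q hq).2.2.1,
    fun h => (hfg _ h).2.2.2.2.2.1 rfl, fun h => (hfg _ h).2.2.2.2.2.2.1 rfl, f, g,
    fun q hq => ?_, ?_, ?_, ?_⟩
  · obtain ⟨a1, a2, a3, a4, a5, a6, a7, a8⟩ := hfg q hq
    exact ⟨hAT _ hq₁ _ a1, a4, hAT _ hq₂ _ a2, a5, a8⟩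
  · refine (Finset.card_le_card ?_).trans (hA q₁ hq₁).2.1
    intro l hl
    obtain ⟨q, hq, rfl⟩ := Finset.mem_image.1 hl
    exact (hfg q hq).1
  · refine (Finset.card_le_card ?_).trans (hA q₂ hq₂).2.1
    intro l hl
    obtain ⟨q, hq, rfl⟩ := Finset.mem_image.1 hl
    exact (hfg q hq).2.1
  · have h1 : (good.card : ℝ) ≤ μ ^ 2 * (fib.image fun w => w.1.2.2).card := by
      rw [← div_le_iff₀' (by positivity)]
      exact hfib.trans (Nat.cast_le.2 hinj)
    exact pencil_count_arith hμ0 hρ0'.le hr0.le hW hgood_card h1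

theorem rich_points_arith {μ n ρ r N S : ℝ} (hμ : 0 ≤ μ) (hρ : 0 < ρ) (hr : 0 ≤ r) (hn : 0 ≤ n)
    (hN : 0 ≤ N) (hS : N * r ≤ 2 * S) (hrn : r ^ 2 ≤ 2 * (ρ * n))
    (hS2 : S ^ 2 ≤ ρ * (40 * (2 * (ρ * n) * √(2 * (ρ * n))) + r * (2 * (ρ * n))))
    (hN2 : 9 * (ρ ^ 2 * μ * r ^ 2) ≤ 128 * (n ^ 2 * N)) :
    μ ^ 4 * r ^ 12 * ρ ^ 3 ≤ 10 ^ 10 * n ^ 11 := by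
  have hM0 : 0 ≤ 2 * (ρ * n) := by positivity
  set M := 2 * (ρ * n) with hM
  have hrM : r ≤ √M := Real.le_sqrt_of_sq_le hrn
  have h1 : S ^ 2 ≤ 41 * (ρ * (M * √M)) := by
    have : r * M ≤ √M * M := mul_le_mul_of_nonneg_right hrM hM0
    nlinarith
  have h2 : S ^ 4 ≤ 1681 * (ρ ^ 2 * M ^ 3) := by
    calc S ^ 4 = (S ^ 2) ^ 2 := by ring
      _ ≤ (41 * (ρ * (M * √M))) ^ 2 := pow_le_pow_left₀ (by positivity) h1 2
      _ = 1681 * (ρ ^ 2 * M ^ 2 * (√M) ^ 2) := by ring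
      _ = 1681 * (ρ ^ 2 * M ^ 3) := by rw [Real.sq_sqrt hM0]; ring
  have h3 : (N * r) ^ 4 ≤ 16 * (1681 * (ρ ^ 2 * M ^ 3)) := by
    calc (N * r) ^ 4 ≤ (2 * S) ^ 4 := pow_le_pow_left₀ (by positivity) hS 4
      _ = 16 * S ^ 4 := by ring
      _ ≤ _ := by gcongr
  have h4 : (9 * (ρ ^ 2 * μ * r ^ 2)) ^ 4 ≤ (128 * (n ^ 2 * N)) ^ 4 :=
    pow_le_pow_left₀ (by positivity) hN2 4
  apply le_of_mul_le_mul_left _ (show (0 : ℝ) < 6561 * ρ ^ 5 by positivity)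
  calc 6561 * ρ ^ 5 * (μ ^ 4 * r ^ 12 * ρ ^ 3) = (9 * (ρ ^ 2 * μ * r ^ 2)) ^ 4 * r ^ 4 := by ring
    _ ≤ (128 * (n ^ 2 * N)) ^ 4 * r ^ 4 := by gcongr
    _ = 128 ^ 4 * n ^ 8 * (N * r) ^ 4 := by ring
    _ ≤ 128 ^ 4 * n ^ 8 * (16 * (1681 * (ρ ^ 2 * M ^ 3))) := by gcongr
    _ = (128 ^ 5 * 1681) * (ρ ^ 5 * n ^ 11) := by rw [hM]; ring
    _ ≤ (6561 * 10 ^ 10) * (ρ ^ 5 * n ^ 11) :=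
      mul_le_mul_of_nonneg_right (by norm_num) (by positivity)
    _ = _ := by ring

/-- A bound for the number of points incident to at least `r` lines. -/
theorem card_rich_points_pow_le {F : Type} [Field F] (Q : Finset (F × F))
    (L : Finset (Set (F × F))) (hL : ∀ ℓ ∈ L, IsLine ℓ) {r ρ : ℕ} (hρ0 : 0 < ρ) (hρr : ρ ≤ r)
    (hr2 : 2 ≤ r) (hrn : r ^ 2 ≤ ρ * L.card) (hn : 32 * L.card ≤ ρ * r ^ 2)
    (hQ : ∀ q ∈ Q, r ≤ (L.filter fun ℓ => q ∈ ℓ).card)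
    (hF : ∀ j : ℕ, 0 < j → (j : ℝ) ≤ 20 * √(2 * (ρ * L.card) : ℕ) → (j : F) ≠ 0) :
    Q.card * r ≤ 4 * L.card ∨
      (Q.card : ℝ) ^ 4 * (r : ℝ) ^ 12 * (ρ : ℝ) ^ 3 ≤ 10 ^ 10 * (L.card : ℝ) ^ 11 := by
  rcases Q.eq_empty_or_nonempty with rfl | hQne
  · left; simp
  rcases le_total (Q.card * r) (4 * L.card) with h | hI
  · exact Or.inl h
  right
  have hT : ∀ q, ∃ T : Finset (Set (F × F)), q ∈ Q → T ⊆ L.filter (fun ℓ => q ∈ ℓ) ∧ T.card = r := by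
    intro q
    by_cases hq : q ∈ Q
    · obtain ⟨T, hT⟩ := Finset.exists_subset_card_eq (hQ q hq)
      exact ⟨T, fun _ => hT⟩
    · exact ⟨∅, fun h => absurd h hq⟩
  choose T hT using hT
  have hTL : ∀ q ∈ Q, T q ⊆ L := fun q hq => (hT q hq).1.trans (Finset.filter_subset _ _)
  have hmem : ∀ q ∈ Q, ∀ ℓ ∈ T q, q ∈ ℓ := fun q hq ℓ hℓ =>
    (Finset.mem_filter.1 ((hT q hq).1 hℓ)).2
  have hlin : ∀ q ∈ Q, ∀ q' ∈ Q, q ≠ q' → ∀ l ∈ T q, l ∈ T q' → ∀ l' ∈ T q, l' ∈ T q' → l = l' :=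
    fun q hq q' hq' hne l hl hl' l' h h' =>
      IsLine.eq_of_mem_of_mem (hL l (hTL q hq hl)) (hL l' (hTL q hq h)) hne
        (hmem q hq l hl) (hmem q' hq' l hl') (hmem q hq l' h) (hmem q' hq' l' h')
  obtain ⟨q₁, hq₁, q₂, hq₂, hne, P, hP, hq₁P, hq₂P, f, g, hfg, hfc, hgc, hcard⟩ :=
    exists_two_pencils Q L T hTL (fun q hq => (hT q hq).2) hlin hρ0 hρr hQne hn hI
  have hkey := card_incidences_two_pencils_sq_le hne P L hL T (fun q hq => hTL q (hP hq))
    (fun q hq => hmem q (hP hq)) f g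
    (fun q hq => ⟨hL _ (hTL _ hq₁ (hfg q hq).1), hmem _ hq₁ _ (hfg q hq).1,
      hmem _ (hP hq) _ (hfg q hq).2.1⟩)
    (fun q hq => ⟨hL _ (hTL _ hq₂ (hfg q hq).2.2.1), hmem _ hq₂ _ (hfg q hq).2.2.1,
      hmem _ (hP hq) _ (hfg q hq).2.2.2.1⟩)
    (fun q hq => (hfg q hq).2.2.2.2) hq₁P hq₂P hfc hgc
    (fun q hq => (hT q (hP hq)).2.le) hF
  have hS : P.card * r ≤ 2 * ∑ q ∈ P, ((T q).filter fun ℓ => q₁ ∉ ℓ).card := by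
    rw [Finset.mul_sum, ← smul_eq_mul]
    refine Finset.card_nsmul_le_sum _ _ _ fun q hq => ?_
    have h1 : ((T q).filter fun ℓ => q₁ ∈ ℓ).card ≤ 1 := by
      refine Finset.card_le_one.2 fun l hl l' hl' => ?_
      obtain ⟨hl, hl1⟩ := Finset.mem_filter.1 hl
      obtain ⟨hl', hl1'⟩ := Finset.mem_filter.1 hl'
      exact IsLine.eq_of_mem_of_mem (hL l (hTL q (hP hq) hl)) (hL l' (hTL q (hP hq) hl'))
        (fun h : q = q₁ => hq₁P (h ▸ hq)) (hmem q (hP hq) l hl) hl1 (hmem q (hP hq) l' hl') hl1'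
    have h2 := Finset.card_filter_add_card_filter_not (s := T q) (fun ℓ => q₁ ∈ ℓ)
    rw [(hT q (hP hq)).2] at h2
    omega
  rw [max_eq_right hρr] at hkey
  have hS' := (Nat.cast_le (α := ℝ)).2 hS
  have hrn' : (r : ℝ) ^ 2 ≤ ρ * L.card := by exact_mod_cast hrn
  push_cast at hkey hS'
  refine rich_points_arith (Nat.cast_nonneg _) (Nat.cast_pos.2 hρ0) (Nat.cast_nonneg _)
    (Nat.cast_nonneg _) (Nat.cast_nonneg _) hS' ?_ hkey hcard
  have : (0 : ℝ) ≤ ρ * L.card := by positivity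
  linarith

theorem incidences_eq_sum {F : Type*} [Field F] (P : Finset (F × F)) (L : Finset (Set (F × F))) :
    Incidences P L = ∑ q ∈ P, (L.filter fun ℓ => q ∈ ℓ).card := by
  rw [Incidences, ← Finset.card_sigma, ← Finset.card_map (Equiv.sigmaEquivProd _ _).toEmbedding,
    ← Set.ncard_coe_finset]
  congr 1
  ext ⟨q, ℓ⟩
  simp [Set.mem_ofPred_eq]

theorem sum_card_offDiag_lines_le {F : Type} [Field F] (P : Finset (F × F))
    (L : Finset (Set (F × F))) (hL : ∀ ℓ ∈ L, IsLine ℓ) :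
    ∑ q ∈ P, (L.filter fun ℓ => q ∈ ℓ).offDiag.card ≤ L.card ^ 2 := by
  rw [← Finset.card_sigma, pow_two, ← Finset.card_product]
  refine Finset.card_le_card_of_injOn (fun x => x.2) ?_ ?_
  · rintro ⟨q, ℓ, ℓ'⟩ h
    obtain ⟨-, h⟩ := Finset.mem_sigma.1 h
    obtain ⟨h, h', -⟩ := Finset.mem_offDiag.1 h
    exact Finset.mem_coe.2 (Finset.mem_product.2
      ⟨(Finset.mem_filter.1 h).1, (Finset.mem_filter.1 h').1⟩)
  · rintro ⟨q, ℓ, ℓ'⟩ h ⟨q', k, k'⟩ hk heq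
    obtain ⟨-, h⟩ := Finset.mem_sigma.1 h
    obtain ⟨h, h', hne⟩ := Finset.mem_offDiag.1 h
    obtain ⟨-, hk⟩ := Finset.mem_sigma.1 hk
    obtain ⟨hk, hk', -⟩ := Finset.mem_offDiag.1 hk
    simp only [Prod.mk.injEq] at heq
    obtain ⟨rfl, rfl⟩ := heq
    obtain ⟨h1, h2⟩ := Finset.mem_filter.1 h
    obtain ⟨h1', h2'⟩ := Finset.mem_filter.1 h'
    have : q = q' := IsLine.eq_of_mem_of_mem_of_ne (hL _ h1) (hL _ h1') hne h2
      (Finset.mem_filter.1 hk).2 h2' (Finset.mem_filter.1 hk').2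
    rw [this]

/-- Layer-cake bound: a sum is controlled by its superlevel sets below a cut-off and
by its second moment above the cut-off. -/
theorem sum_le_add_sum_card_superlevel {α : Type*} (P : Finset α) (d : α → ℕ) {ρ R : ℕ} :
    R * ∑ q ∈ P, d q ≤ R * (P.card * ρ) +
      R * (∑ r ∈ Finset.Ioc ρ R, (P.filter fun q => r ≤ d q).card) +
      ∑ q ∈ P, (d q * d q - d q) := by
  have h1 : ∑ r ∈ Finset.Ioc ρ R, (P.filter fun q => r ≤ d q).card =
      ∑ q ∈ P, ((Finset.Ioc ρ R).filter fun r => r ≤ d q).card :=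
    (Finset.sum_card_bipartiteAbove_eq_sum_card_bipartiteBelow (s := P) (t := Finset.Ioc ρ R)
      (fun q r => r ≤ d q)).symm
  rw [h1, ← smul_eq_mul (P.card), ← Finset.sum_const, Finset.mul_sum, Finset.mul_sum,
    Finset.mul_sum, ← Finset.sum_add_distrib, ← Finset.sum_add_distrib]
  refine Finset.sum_le_sum fun q _ => ?_
  rcases le_or_gt (d q) R with h | h
  · have h2 : (Finset.Ioc ρ R).filter (fun r => r ≤ d q) = Finset.Ioc ρ (d q) := by
      ext r
      simp only [Finset.mem_filter, Finset.mem_Ioc]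
      omega
    rw [h2, Nat.card_Ioc, ← Nat.mul_add]
    exact (Nat.mul_le_mul_left R (by omega)).trans (Nat.le_add_right _ _)
  · refine le_trans ?_ (Nat.le_add_left _ _)
    obtain ⟨e, he⟩ : ∃ e, d q = e + 1 := ⟨d q - 1, by omega⟩
    have : d q * d q - d q = e * d q := by
      conv_lhs => rw [he]
      rw [he, Nat.add_mul, one_mul, Nat.add_sub_cancel]
    rw [this]
    exact Nat.mul_le_mul_right _ (by omega)

section Arithmetic

variable {m n ρ r μ : ℝ}

theorem threshold_cube_ge (hm : 0 < m) (hn : 0 ≤ n) (hρ : 0 ≤ ρ) (hmn : m ^ 4 ≤ n ^ 6)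
    (h : 4 ^ 15 * n ^ 11 ≤ m ^ 4 * ρ ^ 15) : 32 * n ≤ ρ ^ 3 := by
  refine le_of_pow_le_pow_left₀ (n := 5) (by norm_num) (by positivity) ?_
  apply le_of_mul_le_mul_left _ (pow_pos hm 4)
  calc m ^ 4 * (32 * n) ^ 5 ≤ n ^ 6 * (32 * n) ^ 5 := by gcongr
    _ = 32 ^ 5 * n ^ 11 := by ring
    _ ≤ 4 ^ 15 * n ^ 11 := mul_le_mul_of_nonneg_right (by norm_num) (by positivity)
    _ ≤ m ^ 4 * ρ ^ 15 := h
    _ = m ^ 4 * (ρ ^ 3) ^ 5 := by ring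

theorem cube_le_of_threshold (hn : 0 ≤ n) (hρ : 0 ≤ ρ) (hnm : n ^ 4 ≤ m ^ 6)
    (h : 4 ^ 15 * n ^ 11 ≤ m ^ 4 * ρ ^ 15) : n ^ 3 ≤ m ^ 2 * ρ ^ 3 := by
  refine le_of_pow_le_pow_left₀ (n := 5) (by norm_num) (by positivity) ?_
  calc (n ^ 3) ^ 5 = n ^ 4 * n ^ 11 := by ring
    _ ≤ m ^ 6 * n ^ 11 := by gcongr
    _ ≤ m ^ 6 * (4 ^ 15 * n ^ 11) := mul_le_mul_of_nonneg_left
      (le_mul_of_one_le_left (by positivity) (by norm_num)) (by positivity)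
    _ ≤ m ^ 6 * (m ^ 4 * ρ ^ 15) := mul_le_mul_of_nonneg_left h (by positivity)
    _ = (m ^ 2 * ρ ^ 3) ^ 5 := by ring

theorem mul_sq_le_of_mul_le (hm : 0 ≤ m) (hρ : 0 ≤ ρ) (hr : 0 ≤ r) (h : μ * r ≤ 4 * n)
    (hrn : r ^ 2 ≤ ρ * n) (hn3 : n ^ 3 ≤ m ^ 2 * ρ ^ 3) : μ * r ^ 2 ≤ 4 * (m * ρ ^ 2) := by
  have h3 : n * r ≤ m * ρ ^ 2 := by
    refine le_of_pow_le_pow_left₀ (n := 2) (by norm_num) (by positivity) ?_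
    calc (n * r) ^ 2 = n ^ 2 * r ^ 2 := by ring
      _ ≤ n ^ 2 * (ρ * n) := by gcongr
      _ = ρ * n ^ 3 := by ring
      _ ≤ ρ * (m ^ 2 * ρ ^ 3) := by gcongr
      _ = (m * ρ ^ 2) ^ 2 := by ring
  have h4 := mul_le_mul_of_nonneg_right h hr
  linarith

theorem mul_sq_le_of_pow_le (hm : 0 ≤ m) (hρ : 0 < ρ) (hμ : 0 ≤ μ) (hρr : ρ ≤ r)
    (h : μ ^ 4 * r ^ 12 * ρ ^ 3 ≤ 10 ^ 10 * n ^ 11)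
    (hn : 4 ^ 15 * n ^ 11 ≤ m ^ 4 * ρ ^ 15) : μ * r ^ 2 ≤ 4 * (m * ρ ^ 2) := by
  have h3 : μ * r ^ 3 ≤ 2 * (m * ρ ^ 3) := by
    refine le_of_pow_le_pow_left₀ (n := 4) (by norm_num) (by positivity) ?_
    apply le_of_mul_le_mul_right _ (pow_pos hρ 3)
    have h0 : 0 ≤ m ^ 4 * ρ ^ 15 := by positivity
    calc (μ * r ^ 3) ^ 4 * ρ ^ 3 = μ ^ 4 * r ^ 12 * ρ ^ 3 := by ring
      _ ≤ 10 ^ 10 * n ^ 11 := h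
      _ ≤ 16 * (m ^ 4 * ρ ^ 15) := by linarith
      _ = (2 * (m * ρ ^ 3)) ^ 4 * ρ ^ 3 := by ring
  apply le_of_mul_le_mul_left _ hρ
  have h0 : 0 ≤ m * ρ ^ 3 := by positivity
  calc ρ * (μ * r ^ 2) ≤ r * (μ * r ^ 2) := by gcongr
    _ = μ * r ^ 3 := by ring
    _ ≤ 4 * (m * ρ ^ 3) := by linarith
    _ = ρ * (4 * (m * ρ ^ 2)) := by ring

theorem sq_le_of_cube_le (hm : 0 ≤ m) (hn : 0 ≤ n) (hρ : 0 < ρ) (hr : 0 ≤ r)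
    (h : ρ * n ≤ (2 * r) ^ 2) (hn3 : n ^ 3 ≤ m ^ 2 * ρ ^ 3) : n ^ 2 ≤ r * (2 * (m * ρ)) := by
  refine le_of_pow_le_pow_left₀ (n := 2) (by norm_num) (by positivity) ?_
  apply le_of_mul_le_mul_left _ hρ
  calc ρ * (n ^ 2) ^ 2 = (ρ * n) * n ^ 3 := by ring
    _ ≤ (2 * r) ^ 2 * (m ^ 2 * ρ ^ 3) := by gcongr
    _ = ρ * (r * (2 * (m * ρ))) ^ 2 := by ring

end Arithmetic

theorem incidences_le_of_threshold {F : Type} [Field F] (P : Finset (F × F))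
    (L : Finset (Set (F × F))) (hL : ∀ ℓ ∈ L, IsLine ℓ) {m n ρ : ℕ} (hPm : P.card = m)
    (hLn : L.card = n) (hn0 : 0 < n) (hm0 : 0 < m) (hρ0 : 0 < ρ)
    (hnm : (n : ℝ) ^ 4 ≤ (m : ℝ) ^ 6) (hmn : (m : ℝ) ^ 4 ≤ (n : ℝ) ^ 6)
    (hρ : 4 ^ 15 * (n : ℝ) ^ 11 ≤ (m : ℝ) ^ 4 * (ρ : ℝ) ^ 15)
    (hF : ∀ j : ℕ, 0 < j → (j : ℝ) ≤ 20 * √(2 * (ρ * L.card) : ℕ) → (j : F) ≠ 0) :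
    (Incidences P L : ℝ) ≤ 7 * (m * ρ) := by
  have hn0' : (0 : ℝ) < n := Nat.cast_pos.2 hn0
  have hm0' : (0 : ℝ) < m := Nat.cast_pos.2 hm0
  have hρ0' : (0 : ℝ) < ρ := Nat.cast_pos.2 hρ0
  have h32 := threshold_cube_ge hm0' hn0'.le hρ0'.le hmn hρ
  have hn3 := cube_le_of_threshold hn0'.le hρ0'.le hnm hρ
  set d : F × F → ℕ := fun q => (L.filter fun ℓ => q ∈ ℓ).card with hd
  set R := Nat.sqrt (ρ * n) with hR
  have hR2 : R ^ 2 ≤ ρ * n := by rw [hR]; exact Nat.sqrt_le' _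
  have hRpos : 0 < R := Nat.sqrt_pos.2 (Nat.mul_pos hρ0 hn0)
  have hRlt : ρ * n < (2 * R) ^ 2 :=
    (Nat.lt_succ_sqrt' (ρ * n)).trans_le (Nat.pow_le_pow_left (by rw [← hR]; omega) 2)
  have hR0' : (0 : ℝ) < R := Nat.cast_pos.2 hRpos
  have hrich : ∀ r ∈ Finset.Ioc ρ R, ((P.filter fun q => r ≤ d q).card : ℝ) ≤
      4 * (m * ρ ^ 2) * ((r : ℝ) ^ 2)⁻¹ := by
    intro r hr
    obtain ⟨hr1, hr2⟩ := Finset.mem_Ioc.1 hr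
    have hr0' : (0 : ℝ) < r := Nat.cast_pos.2 (by omega)
    have hρr : (ρ : ℝ) ≤ r := Nat.cast_le.2 hr1.le
    have hrn : r ^ 2 ≤ ρ * L.card := by rw [hLn]; exact (Nat.pow_le_pow_left hr2 2).trans hR2
    have h32r : 32 * L.card ≤ ρ * r ^ 2 := by
      have : 32 * n ≤ ρ ^ 3 := by exact_mod_cast h32
      rw [hLn]
      calc 32 * n ≤ ρ ^ 3 := this
        _ = ρ * ρ ^ 2 := by ring
        _ ≤ ρ * r ^ 2 := Nat.mul_le_mul_left _ (Nat.pow_le_pow_left hr1.le 2)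
    rw [← div_eq_mul_inv, le_div_iff₀ (by positivity)]
    rcases card_rich_points_pow_le (P.filter fun q => r ≤ d q) L hL hρ0 hr1.le (by omega) hrn h32r
      (fun q hq => (Finset.mem_filter.1 hq).2) hF with h | h
    · rw [hLn] at h hrn
      have h' : ((P.filter fun q => r ≤ d q).card : ℝ) * r ≤ 4 * n := by exact_mod_cast h
      have hrn' : (r : ℝ) ^ 2 ≤ ρ * n := by exact_mod_cast hrn
      exact mul_sq_le_of_mul_le hm0'.le hρ0'.le hr0'.le h' hrn' hn3
    · rw [hLn] at h
      exact mul_sq_le_of_pow_le hm0'.le hρ0' (Nat.cast_nonneg _) hρr h hρ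
  have hsum : ((∑ r ∈ Finset.Ioc ρ R, (P.filter fun q => r ≤ d q).card : ℕ) : ℝ) ≤
      4 * (m * ρ) := by
    push_cast
    refine (Finset.sum_le_sum hrich).trans ?_
    rw [← Finset.mul_sum]
    have h1 : ∑ r ∈ Finset.Ioc ρ R, ((r : ℝ) ^ 2)⁻¹ ≤ (ρ : ℝ)⁻¹ := by
      rcases le_total ρ R with h | h
      · refine (sum_Ioc_inv_sq_le_sub hρ0.ne' h).trans ?_
        have : (0 : ℝ) ≤ (R : ℝ)⁻¹ := by positivity
        linarith
      · rw [Finset.Ioc_eq_empty_of_le h, Finset.sum_empty]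
        positivity
    calc 4 * ((m : ℝ) * (ρ : ℝ) ^ 2) * ∑ r ∈ Finset.Ioc ρ R, ((r : ℝ) ^ 2)⁻¹
        ≤ 4 * ((m : ℝ) * (ρ : ℝ) ^ 2) * (ρ : ℝ)⁻¹ := by gcongr
      _ = 4 * ((m : ℝ) * ρ) := by field_simp
  have hoff : ((∑ q ∈ P, (d q * d q - d q) : ℕ) : ℝ) ≤ n ^ 2 := by
    have h := sum_card_offDiag_lines_le P L hL
    simp only [Finset.offDiag_card] at h
    rw [hLn] at h
    exact_mod_cast h
  have hn2 : (n : ℝ) ^ 2 ≤ R * (2 * (m * ρ)) := by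
    exact sq_le_of_cube_le hm0'.le hn0'.le hρ0' hR0'.le (by exact_mod_cast hRlt.le) hn3
  have hlayer := (Nat.cast_le (α := ℝ)).2 (sum_le_add_sum_card_superlevel P d (ρ := ρ) (R := R))
  rw [Nat.cast_add, Nat.cast_add, Nat.cast_mul, Nat.cast_mul, Nat.cast_mul, hPm,
    Nat.cast_mul R] at hlayer
  rw [incidences_eq_sum]
  apply le_of_mul_le_mul_left _ hR0'
  have h2 := mul_le_mul_of_nonneg_left hsum hR0'.le
  calc (R : ℝ) * ((∑ q ∈ P, (L.filter fun ℓ => q ∈ ℓ).card : ℕ) : ℝ) ≤ _ := hlayer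
    _ ≤ R * (m * ρ) + R * (4 * (m * ρ)) + R * (2 * (m * ρ)) := by
      gcongr
      exact hoff.trans hn2
    _ = R * (7 * (m * ρ)) := by ring

theorem natCast_ne_zero_of_le_sqrt {F : Type} [Field F] {m n ρ : ℕ} {X : ℝ} (hm : 0 < m)
    (hX : X ^ 15 = (n : ℝ) ^ 11 / (m : ℝ) ^ 4) (hρX : (ρ : ℝ) ≤ 5 * X)
    (hchar : ∀ p : ℕ, p.Prime → CharP F p →
      (n : ℝ) ^ 13 / (m : ℝ) ^ 2 ≤ (10 ^ 30)⁻¹ * (p : ℝ) ^ 15)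
    (j : ℕ) (hj : 0 < j) (hjle : (j : ℝ) ≤ 20 * √(2 * (ρ * n) : ℕ)) : (j : F) ≠ 0 := by
  obtain ⟨p, hp⟩ := CharP.exists F
  rw [Ne, CharP.cast_eq_zero_iff F p]
  intro hdvd
  rcases CharP.char_is_prime_or_zero F p with hprime | rfl
  · have hm' : (0 : ℝ) < m := Nat.cast_pos.2 hm
    have hp0 : (0 : ℝ) < p := Nat.cast_pos.2 hprime.pos
    have hpj : (p : ℝ) ≤ j := Nat.cast_le.2 (Nat.le_of_dvd hj hdvd)
    have h1 : (p : ℝ) ^ 2 ≤ 800 * (ρ * n) := by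
      have h := pow_le_pow_left₀ hp0.le (hpj.trans hjle) 2
      rw [mul_pow, Real.sq_sqrt (Nat.cast_nonneg _)] at h
      push_cast at h
      linarith
    have h2 : ((ρ : ℝ) * n) ^ 15 ≤ 5 ^ 15 * ((n : ℝ) ^ 13 / (m : ℝ) ^ 2) ^ 2 := by
      calc ((ρ : ℝ) * n) ^ 15 ≤ (5 * X * n) ^ 15 := by gcongr
        _ = 5 ^ 15 * (X ^ 15 * n ^ 15) := by ring
        _ = 5 ^ 15 * ((n : ℝ) ^ 13 / (m : ℝ) ^ 2) ^ 2 := by rw [hX]; field_simp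
    have h3 : ((n : ℝ) ^ 13 / (m : ℝ) ^ 2) ^ 2 ≤ ((10 ^ 30)⁻¹ * (p : ℝ) ^ 15) ^ 2 :=
      pow_le_pow_left₀ (by positivity) (hchar p hprime hp) 2
    have h4 : ((p : ℝ) ^ 2) ^ 15 ≤ 800 ^ 15 * (5 ^ 15 * ((10 ^ 30)⁻¹ * (p : ℝ) ^ 15) ^ 2) := by
      calc ((p : ℝ) ^ 2) ^ 15 ≤ (800 * (ρ * n)) ^ 15 := by gcongr
        _ = 800 ^ 15 * ((ρ : ℝ) * n) ^ 15 := by ring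
        _ ≤ _ := mul_le_mul_of_nonneg_left (h2.trans (by gcongr)) (by positivity)
    have h5 : (0 : ℝ) < (p : ℝ) ^ 30 := by positivity
    have h6 : ((p : ℝ) ^ 2) ^ 15 = (p : ℝ) ^ 30 := by ring
    have h7 : ((10 ^ 30)⁻¹ * (p : ℝ) ^ 15) ^ 2 = (10 ^ 60)⁻¹ * (p : ℝ) ^ 30 := by
      rw [mul_pow, inv_pow]; ring
    rw [h6, h7] at h4
    norm_num at h4
    linarith
  · rw [zero_dvd_iff] at hdvd
    omega

theorem stmt_0 :
    ∃ c C : ℝ, 0 < c ∧ 0 < C ∧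
      ∀ (F : Type) [Field F] (P : Finset (F × F)) (L : Finset (Set (F × F))) (m n : ℕ),
        P.card = m → L.card = n → (∀ ℓ ∈ L, IsLine ℓ) →
        (m : ℝ) ^ ((7 : ℝ) / 8) < (n : ℝ) →
        (n : ℝ) < (m : ℝ) ^ ((8 : ℝ) / 7) →
        (∀ p : ℕ, p.Prime → CharP F p →
          (n : ℝ) ^ 13 / (m : ℝ) ^ 2 ≤ c * (p : ℝ) ^ 15) →
        (Incidences P L : ℝ) ≤ C * (m : ℝ) ^ ((11 : ℝ) / 15) * (n : ℝ) ^ ((11 : ℝ) / 15) := by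
  refine ⟨(10 ^ 30)⁻¹, 35, by positivity, by norm_num, ?_⟩
  intro F _ P L m n hPm hLn hL h1 h2 hchar
  have hn : (0 : ℝ) < n := lt_of_le_of_lt (by positivity) h1
  have hm : 0 < m := by
    rcases Nat.eq_zero_or_pos m with rfl | h
    · rw [Nat.cast_zero, Real.zero_rpow (by norm_num)] at h2
      linarith
    · exact h
  have hm' : (0 : ℝ) < m := Nat.cast_pos.2 hm
  have hm1 : (1 : ℝ) ≤ m := by exact_mod_cast hm
  have hn1 : (1 : ℝ) ≤ n := by
    have := Nat.cast_pos.1 hn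
    exact_mod_cast this
  have h78 : (m : ℝ) ^ 7 ≤ n ^ 8 := by
    have h := pow_le_pow_left₀ (by positivity) h1.le 8
    rw [← Real.rpow_mul_natCast hm'.le] at h
    norm_num at h
    exact_mod_cast h
  have h87 : (n : ℝ) ^ 7 ≤ m ^ 8 := by
    have h := pow_le_pow_left₀ hn.le h2.le 7
    rw [← Real.rpow_mul_natCast hm'.le] at h
    norm_num at h
    exact_mod_cast h
  have hmn : (m : ℝ) ^ 4 ≤ n ^ 6 := by
    refine le_of_pow_le_pow_left₀ (n := 8) (by norm_num) (by positivity) ?_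
    calc ((m : ℝ) ^ 4) ^ 8 = (m : ℝ) ^ 32 := by ring
      _ ≤ (m : ℝ) ^ 42 := pow_le_pow_right₀ hm1 (by norm_num)
      _ = ((m : ℝ) ^ 7) ^ 6 := by ring
      _ ≤ ((n : ℝ) ^ 8) ^ 6 := by gcongr
      _ = ((n : ℝ) ^ 6) ^ 8 := by ring
  have hnm : (n : ℝ) ^ 4 ≤ m ^ 6 := by
    refine le_of_pow_le_pow_left₀ (n := 7) (by norm_num) (by positivity) ?_
    calc ((n : ℝ) ^ 4) ^ 7 = ((n : ℝ) ^ 7) ^ 4 := by ring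
      _ ≤ ((m : ℝ) ^ 8) ^ 4 := by gcongr
      _ = (m : ℝ) ^ 32 := by ring
      _ ≤ (m : ℝ) ^ 42 := pow_le_pow_right₀ hm1 (by norm_num)
      _ = ((m : ℝ) ^ 6) ^ 7 := by ring
  set X : ℝ := (n : ℝ) ^ ((11 : ℝ) / 15) / (m : ℝ) ^ ((4 : ℝ) / 15) with hXdef
  have hX0 : 0 < X := by positivity
  have hX : X ^ 15 = (n : ℝ) ^ 11 / (m : ℝ) ^ 4 := by
    rw [hXdef, div_pow, ← Real.rpow_mul_natCast hn.le, ← Real.rpow_mul_natCast hm'.le,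
      ← Real.rpow_natCast, ← Real.rpow_natCast]
    norm_num
  have hX1 : 1 ≤ X := by
    refine le_of_pow_le_pow_left₀ (n := 15) (by norm_num) hX0.le ?_
    rw [one_pow, hX, one_le_div (by positivity)]
    exact hmn.trans (pow_le_pow_right₀ hn1 (by norm_num))
  have hmX : m * X = (m : ℝ) ^ ((11 : ℝ) / 15) * (n : ℝ) ^ ((11 : ℝ) / 15) := by
    have h : (m : ℝ) = (m : ℝ) ^ ((11 : ℝ) / 15) * (m : ℝ) ^ ((4 : ℝ) / 15) := by
      rw [← Real.rpow_add hm']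
      norm_num
    rw [hXdef]
    nth_rewrite 1 [h]
    field_simp
  set ρ := ⌈4 * X⌉₊ with hρ
  have hρl : 4 * X ≤ ρ := Nat.le_ceil _
  have hρu : (ρ : ℝ) ≤ 5 * X := by
    have := Nat.ceil_lt_add_one (a := 4 * X) (by positivity)
    linarith
  have hρ15 : 4 ^ 15 * (n : ℝ) ^ 11 ≤ (m : ℝ) ^ 4 * (ρ : ℝ) ^ 15 := by
    calc 4 ^ 15 * (n : ℝ) ^ 11 = (m : ℝ) ^ 4 * (4 * X) ^ 15 := by
          rw [mul_pow, hX]; field_simp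
      _ ≤ _ := by gcongr
  have hρ0 : 0 < ρ := Nat.ceil_pos.2 (by positivity)
  have hmain := incidences_le_of_threshold P L hL hPm hLn (Nat.cast_pos.1 hn) hm hρ0 hnm hmn hρ15
    (by rw [hLn]; exact natCast_ne_zero_of_le_sqrt hm hX hρu hchar)
  calc (Incidences P L : ℝ) ≤ 7 * (m * ρ) := hmain
    _ ≤ 7 * (m * (5 * X)) := by gcongr
    _ = 35 * (m * X) := by ring
    _ = 35 * (m : ℝ) ^ ((11 : ℝ) / 15) * (n : ℝ) ^ ((11 : ℝ) / 15) := by rw [hmX, mul_assoc]
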